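/- Under the standing hypotheses, no cycle of length g in G shares an edge with any cycle of length g+1 in G. -/

import Mathlib

open SimpleGraph

/-- Two graphs have the same `k`-deck if there is a bijection between their `k`-element
vertex subsets under which corresponding induced subgraphs are isomorphic. -/
def SameDeck {V W : Type*} [Fintype V] [Fintype W] [DecidableEq V] [DecidableEq W]
    (G : SimpleGraph V) (H : SimpleGraph W) (k : ℕ) : Prop :=
  ∃ e : {s : Finset V // s.card = k} ≃ {s : Finset W // s.card = k},
    ∀ s : {s : Finset V // s.card = k},
      Nonempty ((G.induce (↑s.1 : Set V)) ≃g (H.induce (↑(e s).1 : Set W)))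

/-- A closed walk of length `m` without backtracking, as an `m`-periodic sequence. -/
structure IsCyc {V : Type*} (G : SimpleGraph V) (m : ℤ) (c : ℤ → V) : Prop where
  periodic : ∀ i, c (i + m) = c i
  adj : ∀ i, G.Adj (c i) (c (i + 1))
  ne : ∀ i, c i ≠ c (i + 2)

/-- Every closed walk of positive length without interior backtracking has length at least `g`. -/
def GirthGE {V : Type*} (G : SimpleGraph V) (g : ℤ) : Prop :=
  ∀ (n : ℤ) (f : ℤ → V), 1 ≤ n → (∀ i, 0 ≤ i → i < n → G.Adj (f i) (f (i + 1))) →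
    (∀ i, 0 ≤ i → i + 2 ≤ n → f i ≠ f (i + 2)) → f 0 = f n → g ≤ n

/-- The graph obtained by replacing the edges `ub`, `wd` with `ud`, `wb`. -/
def switchGraph {V : Type*} (G : SimpleGraph V) (u w b d : V) : SimpleGraph V :=
  (G \ fromEdgeSet {s(u, b), s(w, d)}) ⊔ fromEdgeSet {s(u, d), s(w, b)}

/-- Every vertex has exactly three neighbours. -/
def IsCubic {V : Type*} (G : SimpleGraph V) : Prop :=
  ∀ v, ∃ a b c, a ≠ b ∧ a ≠ c ∧ b ≠ c ∧ ∀ x, G.Adj v x ↔ x = a ∨ x = b ∨ x = c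

/-- A family of cubic graphs of girth at least `g` closed under one of the two possible switches
at any two vertices that are adjacent or have a common neighbour, whose members all have equally
many `g`-cycles. -/
structure SwitchFamily {V : Type*} (B : Set (SimpleGraph V)) (g : ℤ) : Prop where
  five_le : 5 ≤ g
  cubic : ∀ K ∈ B, IsCubic K
  girth : ∀ K ∈ B, GirthGE K g
  exchange : ∀ K ∈ B, ∀ K' ∈ B, (∀ c, IsCyc K g c → IsCyc K' g c) → ∀ c, IsCyc K' g c → IsCyc K g c
  switch_or : ∀ K ∈ B, ∀ u w a b c d x y, u ≠ w → a ≠ b → a ≠ x → b ≠ x → c ≠ d → c ≠ y → d ≠ y →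
    (∀ z, K.Adj u z ↔ z = a ∨ z = b ∨ z = x) → (∀ z, K.Adj w z ↔ z = c ∨ z = d ∨ z = y) →
    (x = w ∧ y = u ∨ x = y) → switchGraph K u w b d ∈ B ∨ switchGraph K u w b c ∈ B

section
variable {V : Type*} {G K : SimpleGraph V} {B : Set (SimpleGraph V)} {g m : ℤ} {c z : ℤ → V}

lemma switchGraph_adj {u w b d x y : V} : (switchGraph G u w b d).Adj x y ↔
    (G.Adj x y ∧ s(x, y) ≠ s(u, b) ∧ s(x, y) ≠ s(w, d)) ∨
      (x ≠ y ∧ (s(x, y) = s(u, d) ∨ s(x, y) = s(w, b))) := by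
  simp only [switchGraph, sup_adj, sdiff_adj, fromEdgeSet_adj, Set.mem_insert_iff,
    Set.mem_singleton_iff]
  constructor
  · rintro (⟨h, h'⟩ | ⟨h, h'⟩)
    · left; refine ⟨h, ?_, ?_⟩ <;> intro e <;> exact h' ⟨by simp [e], h.ne⟩
    · exact Or.inr ⟨h', h⟩
  · rintro (⟨h, h1, h2⟩ | ⟨h, h'⟩)
    · left; exact ⟨h, fun h' => h'.1.elim h1 h2⟩
    · exact Or.inr ⟨h', h⟩

lemma IsCyc.adj' (h : IsCyc G m c) {i j : ℤ} (hij : j = i + 1) : G.Adj (c i) (c j) := hij ▸ h.adj i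

lemma IsCyc.ne' (h : IsCyc G m c) {i j : ℤ} (hij : j = i + 2) : c i ≠ c j := hij ▸ h.ne i

lemma IsCyc.per (h : IsCyc G m c) {i j : ℤ} (hij : j = i + m) : c j = c i := hij ▸ h.periodic i

lemma IsCyc.shift (h : IsCyc G m c) (k : ℤ) : IsCyc G m (fun i => c (i + k)) :=
  ⟨fun _ => h.per (by ring), fun _ => h.adj' (by ring), fun _ => h.ne' (by ring)⟩

lemma IsCyc.reflect (h : IsCyc G m c) (k : ℤ) : IsCyc G m (fun i => c (k - i)) :=
  ⟨fun _ => (h.per (by ring)).symm, fun _ => (h.adj' (by ring)).symm,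
    fun _ => (h.ne' (by ring)).symm⟩

lemma IsCyc.mono (h : IsCyc G m c) (h' : ∀ i, K.Adj (c i) (c (i + 1))) : IsCyc K m c :=
  ⟨h.periodic, h', h.ne⟩

lemma IsCyc.emod (h : IsCyc G m c) (i : ℤ) : c (i % m) = c i := by
  have key : ∀ (n : ℕ) (i : ℤ), c (i + m * n) = c i := by
    intro n
    induction n with
    | zero => simp
    | succ n ih => intro i; rw [← ih i]; exact h.per (by push_cast; ring)
  have e := Int.emod_add_mul_ediv i m
  rcases Int.eq_nat_or_neg (i / m) with ⟨n, hn | hn⟩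
  · rw [hn] at e; rw [← key n (i % m), e]
  · rw [hn] at e; rw [← key n i]; congr 1; linarith

lemma IsCyc.exists_index (h : IsCyc G m c) (hm : 0 < m) (k i : ℤ) :
    ∃ r, 0 ≤ r ∧ r < m ∧ c i = c (k + r) := by
  refine ⟨(i - k) % m, Int.emod_nonneg _ hm.ne', Int.emod_lt_of_pos _ hm, ?_⟩
  have := (h.shift k).emod (i - k)
  simp only [sub_add_cancel] at this
  rw [← this, add_comm]

lemma IsCyc.injOn (h : IsCyc G m c) (hG : GirthGE G g) (hm : m ≤ g + 1) {i j : ℤ}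
    (hij : i < j) (hjm : j < i + m) : c i ≠ c j := by
  intro e
  have h1 := hG (j - i) (fun t => c (i + t)) (by linarith)
    (fun t _ _ => h.adj' (by ring)) (fun t _ _ => h.ne' (by ring)) (by simpa using e)
  have : m = j - i + 1 := by linarith
  have h2 := h.adj j
  rw [h.per (i := i) (j := j + 1) (by linarith), e] at h2
  exact h2.ne rfl

lemma isCyc_of_injOn {f : ℤ → V} (hm : 3 ≤ m)
    (hadj : ∀ i, 0 ≤ i → i + 1 < m → G.Adj (f i) (f (i + 1))) (hlast : G.Adj (f (m - 1)) (f 0))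
    (hinj : ∀ i j, 0 ≤ i → i < j → j < m → f i ≠ f j) : IsCyc G m (fun i => f (i % m)) := by
  have hb : ∀ i : ℤ, 0 ≤ i % m ∧ i % m < m := fun i =>
    ⟨Int.emod_nonneg _ (by linarith), Int.emod_lt_of_pos _ (by linarith)⟩
  have hk : ∀ i k : ℤ, 0 ≤ k → k < m →
      (i + k) % m = i % m + k ∧ i % m + k < m ∨ (i + k) % m = i % m + k - m := by
    intro i k h0 hk
    have h1 := hb i
    rw [← Int.emod_add_emod]
    rcases lt_or_ge (i % m + k) m with h | h
    · exact Or.inl ⟨Int.emod_eq_of_lt (by linarith) h, h⟩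
    · right
      rw [← Int.sub_emod_right]
      exact Int.emod_eq_of_lt (by linarith) (by linarith)
  refine ⟨fun i => by simp, fun i => ?_, fun i => ?_⟩
  · have h1 := hb i
    rcases hk i 1 (by simp) (by linarith) with ⟨h, h'⟩ | h
    · simp only [h]; exact hadj _ h1.1 h'
    · have h2 := hb (i + 1)
      have e1 : i % m = m - 1 := by linarith
      simp only [h, e1]
      simpa using hlast
  · have h1 := hb i
    have h2 := hb (i + 2)
    rcases hk i 2 (by simp) (by linarith) with ⟨h, h'⟩ | h
    · simp only [h]; exact hinj _ _ h1.1 (by linarith) h'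
    · simp only [h] at h2 ⊢; exact (hinj _ _ h2.1 (by linarith) h1.2).symm

lemma IsCubic.exists_third (hK : IsCubic K) {v a b : V} (ha : K.Adj v a) (hb : K.Adj v b)
    (hab : a ≠ b) :
    ∃ c, c ≠ a ∧ c ≠ b ∧ ∀ x, K.Adj v x ↔ x = c ∨ x = a ∨ x = b := by
  obtain ⟨p, q, r, h1, h2, h3, h⟩ := hK v
  have ha' := (h a).1 ha
  have hb' := (h b).1 hb
  rcases ha' with rfl | rfl | rfl <;> rcases hb' with rfl | rfl | rfl <;>
    first
    | exact absurd rfl hab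
    | exact ⟨p, by grind, by grind, by grind⟩
    | exact ⟨q, by grind, by grind, by grind⟩
    | exact ⟨r, by grind, by grind, by grind⟩

namespace SwitchFamily
variable (hB : SwitchFamily B g)
include hB

lemma exists_third (hK : K ∈ B) {v a b : V} (ha : K.Adj v a) (hb : K.Adj v b) (hab : a ≠ b) :
    ∃ c, c ≠ a ∧ c ≠ b ∧ ∀ x, K.Adj v x ↔ x = c ∨ x = a ∨ x = b :=
  (hB.cubic K hK).exists_third ha hb hab

/-- A cycle of length `g + k - 1` cannot be shortcut by replacing `k` steps with a single edge. -/
lemma not_shortcut (hK : K ∈ B) {K' : SimpleGraph V} (hK' : K' ∈ B) {k : ℤ} (hk : 1 ≤ k)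
    (hk' : k ≤ 2) (hc : IsCyc K (g + k - 1) c)
    (hadj : ∀ t, k ≤ t → t + 1 < g + k - 1 → K'.Adj (c t) (c (t + 1)))
    (hlast : K'.Adj (c (-1)) (c k)) : False := by
  have h5 := hB.five_le
  have := hB.girth K' hK' (g - 1) (fun t => if t < g - 1 then c (k + t) else c k) (by linarith)
    ?_ ?_ ?_
  · linarith
  · intro i h0 h1
    simp only [h1, if_true]
    split_ifs with h2
    · rw [← add_assoc]; exact hadj _ (by linarith) (by linarith)
    · have e : c (k + i) = c (-1) := hc.per (by linarith)
      rw [e]; exact hlast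
  · intro i h0 h1
    have h2 : i < g - 1 := by linarith
    simp only [h2, if_true]
    split_ifs with h3
    · exact hc.ne' (by ring)
    · exact (hc.injOn (hB.girth K hK) (by linarith) (by linarith) (by linarith)).symm
  · simp

lemma switch_mem (hK : K ∈ B) {k : ℤ} (hk : k = 1 ∨ k = 2) (hc : IsCyc K (g + k - 1) c) :
    switchGraph K (c 0) (c k) (c (-1)) (c (k + 1)) ∈ B := by
  have h5 := hB.five_le
  have hk1 : 1 ≤ k := by omega
  have hk2 : k ≤ 2 := by omega
  have inj : ∀ {i j : ℤ}, i < j → j < i + (g + k - 1) → c i ≠ c j := fun h h' =>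
    hc.injOn (hB.girth K hK) (by linarith) h h'
  obtain ⟨a, ha1, ha2, ha⟩ := hB.exists_third hK (v := c 0) (a := c (-1)) (b := c 1)
    (hc.adj' (by ring)).symm (hc.adj' (by ring)) (hc.ne' (by ring))
  obtain ⟨e, he1, he2, he⟩ := hB.exists_third hK (v := c k) (a := c (k + 1)) (b := c (k - 1))
    (hc.adj' (by ring)) (hc.adj' (by ring)).symm (hc.ne' (by ring)).symm
  rcases hB.switch_or K hK (c 0) (c k) a (c (-1)) e (c (k + 1)) (c 1) (c (k - 1))
    (inj (by linarith) (by linarith)) ha1 ha2 (hc.ne' (by ring)) he1 he2 (hc.ne' (by ring)).symm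
    ha he (by rcases hk with rfl | rfl <;> simp) with h | h
  · exact h
  exfalso
  refine hB.not_shortcut hK h hk1 hk2 hc (fun t h0 h1 => ?_) ?_
  · rw [switchGraph_adj]
    refine Or.inl ⟨hc.adj _, ?_, ?_⟩
    · rw [Ne, Sym2.eq_iff]
      rintro (⟨h1, -⟩ | ⟨-, h1⟩)
      · exact inj (by linarith) (by linarith) h1.symm
      · exact inj (by linarith) (by linarith) h1.symm
    · rw [Ne, Sym2.eq_iff]
      rintro (⟨h1, h2⟩ | ⟨h1, h2⟩)
      · rcases eq_or_lt_of_le h0 with rfl | h0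
        · exact he1 h2.symm
        · exact inj (by linarith) (by linarith) h1.symm
      · exact inj (by linarith) (by linarith) h2.symm
  · rw [switchGraph_adj]
    have : c (-1) ≠ c k := inj (by linarith) (by linarith)
    exact Or.inr ⟨this, Or.inr Sym2.eq_swap⟩

/-- The same switch performed on the edges leaving the cycle. -/
lemma switch_pendant_mem (hK : K ∈ B) (hc : IsCyc K g c) {a e : V}
    (ha : K.Adj (c 0) a) (ha1 : a ≠ c (-1)) (ha2 : a ≠ c 1)
    (he : K.Adj (c 1) e) (he1 : e ≠ c 0) (he2 : e ≠ c 2) :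
    switchGraph K (c 0) (c 1) a e ∈ B := by
  have h5 := hB.five_le
  have inj : ∀ {i j : ℤ}, i < j → j < i + g → c i ≠ c j := fun h h' =>
    hc.injOn (hB.girth K hK) (by linarith) h h'
  obtain ⟨a', -, -, ha'⟩ := hB.exists_third hK (v := c 0) (a := c (-1)) (b := c 1)
    (hc.adj' (by ring)).symm (hc.adj' (by ring)) (hc.ne' (by ring))
  obtain ⟨e', -, -, he'⟩ := hB.exists_third hK (v := c 1) (a := c 2) (b := c 0)
    (hc.adj' (by ring)) (hc.adj' (by ring)).symm (hc.ne' (by ring)).symm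
  obtain rfl : a = a' := by have := (ha' a).1 ha; tauto
  obtain rfl : e = e' := by have := (he' e).1 he; tauto
  rcases hB.switch_or K hK (c 0) (c 1) (c (-1)) a (c 2) e (c 1) (c 0)
    (inj (by linarith) (by linarith)) ha1.symm (hc.ne' (by ring)) ha2 he2.symm
    (hc.ne' (by ring)).symm he1 (fun z => (ha' z).trans or_left_comm)
    (fun z => (he' z).trans or_left_comm) (by simp) with h | h
  · exact h
  exfalso
  refine hB.not_shortcut hK h (k := 1) le_rfl (by simp) (c := fun t => c (t + 1))
    (by simpa using hc.shift 1) (fun t h0 h1 => ?_) ?_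
  · rw [switchGraph_adj]
    refine Or.inl ⟨hc.adj _, ?_, ?_⟩
    · rw [Ne, Sym2.eq_iff]
      rintro (⟨h1, -⟩ | ⟨h1, h2⟩)
      · exact inj (by linarith) (by linarith) h1.symm
      · rcases eq_or_lt_of_le (show t + 1 + 1 ≤ g by linarith) with h3 | h3
        · exact ha1 (h1.symm.trans (hc.per (by linarith)))
        · exact inj (by linarith) (by linarith) h2.symm
    · rw [Ne, Sym2.eq_iff]
      rintro (⟨h1, h2⟩ | ⟨h1, h2⟩)
      · exact inj (by linarith) (by linarith) h1.symm
      · exact inj (by linarith) (by linarith) h2.symm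
  · rw [switchGraph_adj]
    have : c 0 ≠ c 2 := inj (by linarith) (by linarith)
    exact Or.inr ⟨this, Or.inl rfl⟩

end SwitchFamily
end

section
variable {V : Type*} {G K : SimpleGraph V} {B : Set (SimpleGraph V)} {g m : ℤ} {c z : ℤ → V}

namespace SwitchFamily
variable (hB : SwitchFamily B g)
include hB

/-- Two `g`-cycles sharing two consecutive edges share the next one. -/
lemma cyc_unique (hK : K ∈ B) (hc : IsCyc K g c) (hz : IsCyc K g z) (h0 : c 0 = z 0)
    (h1 : c 1 = z 1) (h2 : c 2 = z 2) : c 3 = z 3 := by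
  by_contra h3
  have h5 := hB.five_le
  have inj : ∀ {i j : ℤ}, i < j → j < i + g → z i ≠ z j := fun h h' =>
    hz.injOn (hB.girth K hK) (by linarith) h h'
  have hK' := hB.switch_mem hK (k := 1) (Or.inl rfl) (c := fun t => c (t + 1))
    (by simpa using hc.shift 1)
  norm_num at hK'
  rw [h0, h1, h2] at hK'
  refine hB.not_shortcut hK hK' (k := 1) le_rfl (by simp) (c := fun t => z (t + 1))
    (by simpa using hz.shift 1) (fun t h0 h1 => ?_) ?_
  · rw [switchGraph_adj]
    refine Or.inl ⟨hz.adj _, ?_, ?_⟩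
    · rw [Ne, Sym2.eq_iff]
      rintro (⟨h1, -⟩ | ⟨h1, h2⟩)
      · exact inj (by linarith) (by linarith) h1.symm
      · exact inj (by linarith) (by linarith) h2.symm
    · rw [Ne, Sym2.eq_iff]
      rintro (⟨h1, h2⟩ | ⟨h1, h2⟩)
      · rcases eq_or_lt_of_le h0 with rfl | h0
        · exact h3 h2.symm
        · exact inj (by linarith) (by linarith) h1.symm
      · exact inj (by linarith) (by linarith) h2.symm
  · rw [switchGraph_adj]
    exact Or.inr ⟨hz.ne' (by ring), Or.inr Sym2.eq_swap⟩

end SwitchFamily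

/-- A path of `K`-edges leaving a cycle and first returning to it is not too short. -/
lemma GirthGE.return_le (hG : GirthGE K g) (hc : IsCyc K m c) {p r j : ℤ} {f : ℤ → V}
    (hf : ∀ i, 0 ≤ i → i < j → K.Adj (f i) (f (i + 1)))
    (hf' : ∀ i, 0 ≤ i → i + 2 ≤ j → f i ≠ f (i + 2)) (hj : 1 ≤ j) (hr : 0 ≤ r)
    (h0 : f 0 = c p) (hend : f j = c (p + r))
    (hlast : f (j - 1) ≠ c (p + r - 1)) : g ≤ j + r := by
  refine hG (j + r) (fun t => if t ≤ j then f t else c (p + r + j - t)) (by linarith) ?_ ?_ ?_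
  · intro i h0 h1
    rcases lt_trichotomy i j with h | rfl | h
    · simp only [h.le, if_true, show i + 1 ≤ j by linarith]
      exact hf _ h0 h
    · simp only [le_refl, if_true, show ¬ i + 1 ≤ i by linarith, if_false, hend]
      exact (hc.adj' (by ring)).symm
    · simp only [show ¬ i ≤ j by linarith, show ¬ i + 1 ≤ j by linarith, if_false]
      exact (hc.adj' (by ring)).symm
  · intro i h0 h1
    rcases lt_trichotomy (i + 1) j with h | h | h
    · simp only [show i ≤ j by linarith, show i + 2 ≤ j by linarith, if_true]
      exact hf' _ h0 (by linarith)
    · simp only [show i ≤ j by linarith, show ¬ i + 2 ≤ j by linarith, if_true, if_false]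
      convert hlast using 2 <;> linarith
    · rcases eq_or_lt_of_le (show j ≤ i by linarith) with rfl | h'
      · simp only [le_refl, if_true, show ¬ j + 2 ≤ j by linarith, if_false, hend]
        exact (hc.ne' (by ring)).symm
      · simp only [show ¬ i ≤ j by linarith, show ¬ i + 2 ≤ j by linarith, if_false]
        exact (hc.ne' (by ring)).symm
  · simp only [show 0 ≤ j by linarith, if_true]
    split_ifs with h
    · obtain rfl : r = 0 := by linarith
      simp [hend, h0]
    · rw [h0]; congr 1; ring

lemma GirthGE.two_mul_le (hG : GirthGE K g) (hc : IsCyc K m c) (hm : m ≤ g + 1) (hm0 : 0 < m)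
    {p j : ℤ} {f : ℤ → V} (hf : ∀ i, 0 ≤ i → i < j → K.Adj (f i) (f (i + 1)))
    (hf' : ∀ i, 0 ≤ i → i + 2 ≤ j → f i ≠ f (i + 2)) (hj : 1 ≤ j)
    (h0 : f 0 = c p) (h1 : f 1 ≠ c (p + 1)) (h2 : f 1 ≠ c (p - 1))
    (hav : ∀ i, 1 ≤ i → i < j → ∀ s, f i ≠ c s) (hend : ∃ s, f j = c s) :
    2 * g ≤ 2 * j + m := by
  obtain ⟨s, hs⟩ := hend
  obtain ⟨r, hr0, hrm, hr⟩ := hc.exists_index hm0 p s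
  rw [hr] at hs
  have e1 : c (p - 1 + m) = c (p - 1) := hc.periodic _
  have inj : ∀ {i j : ℤ}, i < j → j < i + m → c i ≠ c j := fun h h' => hc.injOn hG hm h h'
  have k1 := hG.return_le hc hf hf' hj hr0 h0 hs (by
    rcases eq_or_lt_of_le hj with rfl | hj
    · rw [sub_self, h0]
      rcases lt_trichotomy r 1 with h | rfl | h
      · exact (hc.adj' (by linarith [show r = 0 by omega])).ne.symm
      · exact absurd hs h1
      · exact inj (by linarith) (by linarith)
    · exact hav _ (by linarith) (by linarith) _)
  have k2 := hG.return_le (hc.reflect (2 * p)) (p := p) (r := m - r) hf hf' hj (by linarith)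
    (by rw [h0]; congr 1; ring)
    (by rw [hs]; exact (hc.per (by ring))) (by
    rcases eq_or_lt_of_le hj with rfl | hj
    · have e : c (2 * p - (p + (m - r) - 1)) = c (p + r + 1) := (hc.per (by ring)).symm
      rw [sub_self, h0, e]
      rcases lt_trichotomy r (m - 1) with h | rfl | h
      · exact inj (by linarith) (by linarith)
      · exact absurd (hs.trans (hc.per (by ring))) h2
      · linarith [show m ≤ r by omega]
    · exact hav _ (by linarith) (by linarith) _)
  linarith

namespace SwitchFamily
variable (hB : SwitchFamily B g)
include hB

/-- A `g`-cycle and an `m`-cycle, `m = g` or `m = g + 1`, that share an edge but no two consecutive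
edges meet only in the ends of that edge. -/
lemma arc_avoids (hK : K ∈ B) (hm : g ≤ m) (hm' : m ≤ g + 1) (hc : IsCyc K m c) (hz : IsCyc K g z)
    {p q : ℤ} (h0 : z 0 = c p) (h1 : z 1 ≠ c (p + 1)) (h2 : z 1 ≠ c (p - 1))
    (h3 : z (-1) = c q) (h4 : z (-2) ≠ c (q + 1)) (h5 : z (-2) ≠ c (q - 1)) {j s : ℤ}
    (hj : 1 ≤ j) (hj' : j ≤ g - 2) : z j ≠ c s := by
  have hg := hB.five_le
  have hG := hB.girth K hK
  intro hjs
  obtain ⟨j₁, ⟨hj1, hj2, s₁, hs1⟩, hmin⟩ := Int.exists_least_of_bdd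
    (P := fun i => 1 ≤ i ∧ i ≤ g - 2 ∧ ∃ s, z i = c s) ⟨1, fun _ h => h.1⟩ ⟨j, hj, hj', s, hjs⟩
  obtain ⟨j₂, ⟨hj3, hj4, s₂, hs2⟩, hmax⟩ := Int.exists_greatest_of_bdd
    (P := fun i => 1 ≤ i ∧ i ≤ g - 2 ∧ ∃ s, z i = c s) ⟨g - 2, fun _ h => h.2.1⟩
    ⟨j, hj, hj', s, hjs⟩
  have k1 := hG.two_mul_le hc hm' (by linarith) (f := z) (fun i _ _ => hz.adj i)
    (fun i _ _ => hz.ne i) hj1 h0 h1 h2 (fun i hi hi' s hs => by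
      linarith [hmin i ⟨hi, by linarith, s, hs⟩]) ⟨s₁, hs1⟩
  have per : ∀ i, z (g - 1 - i) = z (-1 - i) := fun i => hz.per (by ring)
  have k2 := hG.two_mul_le hc hm' (by linarith) (f := fun i => z (-1 - i)) (p := q)
    (j := g - 1 - j₂)
    (fun i _ _ => (hz.adj' (by ring)).symm) (fun i _ _ => (hz.ne' (by ring)).symm) (by linarith)
    (by simpa using h3) (by simpa using h4) (by simpa using h5) (fun i hi hi' s hs => by
      rw [← per] at hs
      linarith [hmax (g - 1 - i) ⟨by linarith, by linarith, s, hs⟩])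
    ⟨s₂, by rw [← hs2]; exact (hz.per (by ring)).symm⟩
  have k3 := hmin j₂ ⟨hj3, hj4, s₂, hs2⟩
  obtain rfl : j₁ = j₂ := by omega
  obtain ⟨t, -, -, ht⟩ := hB.exists_third hK (v := c s₁) (a := c (s₁ - 1)) (b := c (s₁ + 1))
    (hc.adj' (by ring)).symm (hc.adj _) (hc.ne' (by ring))
  have n1 : ∀ s, z (j₁ - 1) ≠ c s := fun s hs => by
    linarith [hmin (j₁ - 1) ⟨by omega, by omega, s, hs⟩]
  have n2 : ∀ s, z (j₁ + 1) ≠ c s := fun s hs => by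
    linarith [hmax (j₁ + 1) ⟨by omega, by omega, s, hs⟩]
  have a1 := (ht (z (j₁ - 1))).1 (by rw [← hs1]; exact (hz.adj' (by ring)).symm)
  have a2 := (ht (z (j₁ + 1))).1 (by rw [← hs1]; exact hz.adj _)
  have := n1 (s₁ - 1)
  have := n1 (s₁ + 1)
  have := n2 (s₁ - 1)
  have := n2 (s₁ + 1)
  exact hz.ne' (i := j₁ - 1) (j := j₁ + 1) (by ring) (by grind)

/-- Two `g`-cycles sharing an edge but no two consecutive edges meet only in that edge. -/
lemma share_avoids (hK : K ∈ B) (hc : IsCyc K g c) (hz : IsCyc K g z) (h0 : z 0 = c 0)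
    (h1 : z 1 ≠ c (-1)) (h2 : z (-1) = c 1) {j s : ℤ} (hj : 1 ≤ j) (hj' : j ≤ g - 2) :
    z j ≠ c s := by
  have h3 : z 1 ≠ c 1 := fun h => hz.ne' (i := -1) (j := 1) (by ring) (h2.trans h.symm)
  refine hB.arc_avoids hK le_rfl (by linarith) hc hz (p := 0) (q := 1) h0 (by simpa using h3)
    (by simpa using h1) h2 (fun h => h1 ?_) (fun h => ?_) hj hj'
  · have := hB.cyc_unique hK (hc.reflect 2) (hz.shift (-2)) (by simpa using h.symm)
      (by simpa using h2.symm) (by simpa using h0.symm)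
    exact (by simpa using this.symm)
  · exact hz.ne' (i := -2) (j := 0) (by ring) (by simpa [h0] using h)

end SwitchFamily
end

section
variable {V : Type*} {G K K' : SimpleGraph V} {B : Set (SimpleGraph V)} {g m : ℤ} {c c' z : ℤ → V}

lemma switchGraph_adj_of_not {S : Set V} {u w b d x y : V} (hu : u ∈ S) (hw : w ∈ S) (hb : b ∈ S)
    (hd : d ∈ S) (h : ¬ (x ∈ S ∧ y ∈ S)) : (switchGraph G u w b d).Adj x y ↔ G.Adj x y := by
  rw [switchGraph_adj]
  simp only [Ne, Sym2.eq_iff]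
  grind

lemma IsCyc.exists_shift (h : IsCyc G m c) (hm : 0 < m) (k i : ℤ) :
    ∃ r, 0 ≤ r ∧ r < m ∧ ∀ t, c (i + t) = c (k + r + t) := by
  refine ⟨(i - k) % m, Int.emod_nonneg _ hm.ne', Int.emod_lt_of_pos _ hm, fun t => ?_⟩
  have := (h.shift (k + t)).emod (i - k)
  rw [show i + t = i - k + (k + t) by ring, ← this]
  congr 1; ring

/-- Two cycles on the same vertices in graphs that agree outside those vertices. -/
structure Rearranged (K : SimpleGraph V) (c : ℤ → V) (K' : SimpleGraph V) (c' : ℤ → V) : Prop where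
  range_eq : Set.range c' = Set.range c
  adj_iff : ∀ x y, ¬ (x ∈ Set.range c ∧ y ∈ Set.range c) → (K'.Adj x y ↔ K.Adj x y)

lemma Rearranged.trans {K'' : SimpleGraph V} {c'' : ℤ → V} (h : Rearranged K c K' c')
    (h' : Rearranged K' c' K'' c'') : Rearranged K c K'' c'' :=
  ⟨h'.range_eq.trans h.range_eq, fun x y hxy =>
    (h'.adj_iff x y (by rwa [h.range_eq])).trans (h.adj_iff x y hxy)⟩

namespace SwitchFamily
variable [DecidableEq V] (hB : SwitchFamily B g)
include hB

/-- Switching two vertices at distance `k` on a cycle of length `g + k - 1` exchanges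
their positions. -/
lemma swap_isCyc (hK : K ∈ B) {k : ℤ} (hk : k = 1 ∨ k = 2) (hc : IsCyc K (g + k - 1) c) :
    IsCyc (switchGraph K (c 0) (c k) (c (-1)) (c (k + 1))) (g + k - 1)
      (fun i => Equiv.swap (c 0) (c k) (c i)) := by
  have h5 := hB.five_le
  have hk1 : 1 ≤ k := by omega
  have hk2 : k ≤ 2 := by omega
  have inj : ∀ {i j : ℤ}, i < j → j < i + (g + k - 1) → c i ≠ c j := fun h h' =>
    hc.injOn (hB.girth K hK) (by linarith) h h'
  refine ⟨fun i => by simp only [hc.periodic], fun i => ?_, fun i h =>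
    hc.ne i ((Equiv.swap (c 0) (c k)).injective h)⟩
  obtain ⟨r, hr0, hr1, hr⟩ := hc.exists_shift (by linarith) (-1) i
  have e0 := hr 0
  rw [add_zero, add_zero] at e0
  simp only [e0, hr 1]
  obtain ⟨j, rfl⟩ : ∃ j, r = j + 1 := ⟨r - 1, by ring⟩
  simp only [show -1 + (j + 1) = j by ring]
  have hj : ∀ {i l : ℤ}, i < l → -1 ≤ i → l < g + k - 2 → c i ≠ c l := fun h h' h'' =>
    inj h (by linarith)
  have old : ∀ i, (0 ≤ i) → i < g + k - 2 → i ≠ k →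
      (switchGraph K (c 0) (c k) (c (-1)) (c (k + 1))).Adj (c i) (c (i + 1)) := by
    intro i hi0 hi1 hik
    rw [switchGraph_adj]
    refine Or.inl ⟨hc.adj i, ?_, ?_⟩
    · rw [Ne, Sym2.eq_iff]
      rintro (⟨h1, h2⟩ | ⟨h1, h2⟩)
      · rcases eq_or_lt_of_le hi0 with rfl | h
        · exact inj (by linarith) (by linarith) h2.symm
        · exact inj h (by linarith) h1.symm
      · exact inj (by linarith) (by linarith) h2.symm
    · rw [Ne, Sym2.eq_iff]
      rintro (⟨h1, h2⟩ | ⟨h1, h2⟩)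
      · rcases lt_or_gt_of_ne hik with h | h
        · exact inj (by linarith) (by linarith) h1
        · exact inj (by linarith) (by linarith) h1.symm
      · rcases lt_trichotomy (i + 1) k with h | h | h
        · exact inj (by linarith) (by linarith) h2
        · exact inj (by linarith) (by linarith) h1
        · exact inj (by omega) (by linarith) h2.symm
  rcases eq_or_lt_of_le (show -1 ≤ j by linarith) with rfl | hj0
  · rw [neg_add_cancel, Equiv.swap_apply_left, Equiv.swap_apply_of_ne_of_ne (hj (by simp) le_rfl
      (by linarith)) (hj (by linarith) le_rfl (by linarith)), switchGraph_adj]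
    exact Or.inr ⟨inj (by linarith) (by linarith), Or.inr Sym2.eq_swap⟩
  rcases lt_trichotomy j k with hjk | rfl | hjk
  · have := old j (by linarith) (by linarith) (by linarith)
    rcases hk with rfl | rfl
    · obtain rfl : j = 0 := by omega
      simpa using this.symm
    · have h10 := old 0 le_rfl (by linarith) (by simp)
      have h21 := old 1 (by simp) (by linarith) (by simp)
      norm_num at h10 h21
      have h1 : Equiv.swap (c 0) (c 2) (c 1) = c 1 :=
        Equiv.swap_apply_of_ne_of_ne h10.ne.symm h21.ne
      obtain rfl | rfl : j = 0 ∨ j = 1 := by omega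
      · simpa [h1] using h21.symm
      · norm_num [h1]
        exact h10.symm
  · have h2 : c (j + 1) ≠ c 0 := by
      rcases eq_or_lt_of_le (show j + 1 ≤ g + j - 2 by linarith) with h | h
      · linarith
      · exact (inj (by linarith) (by linarith)).symm
    rw [Equiv.swap_apply_right, Equiv.swap_apply_of_ne_of_ne h2 (hc.adj _).ne.symm,
      switchGraph_adj]
    exact Or.inr ⟨h2.symm, Or.inl rfl⟩
  · rcases eq_or_lt_of_le (show j + 1 ≤ g + k - 1 by linarith) with h | h
    · linarith
    · rw [Equiv.swap_apply_of_ne_of_ne (inj (by linarith) (by linarith)).symm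
        (inj (by linarith) (by linarith)).symm, Equiv.swap_apply_of_ne_of_ne
        (inj (by linarith) (by linarith)).symm (inj (by linarith) (by linarith)).symm]
      exact old j (by linarith) (by linarith) hjk.ne'

lemma exists_swap (hK : K ∈ B) (hc : IsCyc K g c) (k : ℤ) : ∃ K' ∈ B,
    IsCyc K' g (fun i => Equiv.swap (c k) (c (k + 1)) (c i)) ∧
      Rearranged K c K' (fun i => Equiv.swap (c k) (c (k + 1)) (c i)) := by
  have hc' : IsCyc K (g + 1 - 1) (fun i => c (i + k)) := by simpa using hc.shift k
  have h1 := hB.switch_mem hK (k := 1) (Or.inl rfl) hc'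
  have h2 := (hB.swap_isCyc hK (k := 1) (Or.inl rfl) hc').shift (-k)
  simp only [add_sub_cancel_right, neg_add_cancel_right, zero_add, add_comm (1 : ℤ) k] at h1 h2
  refine ⟨_, h1, h2, ⟨?_, fun x y h => switchGraph_adj_of_not (Set.mem_range_self _)
    (Set.mem_range_self _) ⟨-1 + k, rfl⟩ ⟨1 + 1 + k, rfl⟩ h⟩⟩
  ext x
  simp only [Set.mem_range]
  constructor
  · rintro ⟨i, rfl⟩
    by_cases e1 : c i = c k
    · exact ⟨k + 1, by simp [e1]⟩
    by_cases e2 : c i = c (k + 1)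
    · exact ⟨k, by simp [e2]⟩
    · exact ⟨i, (Equiv.swap_apply_of_ne_of_ne e1 e2).symm⟩
  · rintro ⟨i, rfl⟩
    by_cases e1 : c i = c k
    · exact ⟨k + 1, by simp [e1]⟩
    by_cases e2 : c i = c (k + 1)
    · exact ⟨k, by simp [e2]⟩
    · exact ⟨i, Equiv.swap_apply_of_ne_of_ne e1 e2⟩

lemma exists_rearranged_index (r : ℕ) : ∀ {K : SimpleGraph V} {c : ℤ → V}, K ∈ B → IsCyc K g c →
    ∀ k : ℤ, 0 ≤ k → k + r < g → ∃ K' ∈ B, ∃ c', IsCyc K' g c' ∧ Rearranged K c K' c' ∧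
      c' k = c (k + r) ∧ ∀ i, 0 ≤ i → i < k → c' i = c i := by
  induction r with
  | zero => exact fun {K c} hK hc k _ _ =>
      ⟨K, hK, c, hc, ⟨rfl, fun _ _ _ => Iff.rfl⟩, by simp, fun _ _ _ => rfl⟩
  | succ r ih =>
    intro K c hK hc k hk hr
    push_cast at hr
    obtain ⟨K₁, hK₁, hc₁, hR⟩ := hB.exists_swap hK hc (k + r)
    obtain ⟨K', hK', c', hc', hR', h1, h2⟩ := ih hK₁ hc₁ k hk (by linarith)
    refine ⟨K', hK', c', hc', hR.trans hR', ?_, fun i h0 hi => ?_⟩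
    · rw [h1, Equiv.swap_apply_left]
      congr 1; push_cast; ring
    · have inj : ∀ {i j : ℤ}, i < j → j < i + g → c i ≠ c j := fun h h' =>
        hc.injOn (hB.girth K hK) (by linarith) h h'
      rw [h2 i h0 hi, Equiv.swap_apply_of_ne_of_ne (inj (by linarith) (by linarith))
        (inj (by linarith) (by linarith))]

lemma exists_rearranged (hK : K ∈ B) (hc : IsCyc K g c) {k : ℤ} (hk : 0 ≤ k) {x : V}
    (hx : x ∈ Set.range c) (hne : ∀ i, 0 ≤ i → i < k → c i ≠ x) :
    ∃ K' ∈ B, ∃ c', IsCyc K' g c' ∧ Rearranged K c K' c' ∧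
      c' k = x ∧ ∀ i, 0 ≤ i → i < k → c' i = c i := by
  obtain ⟨i, rfl⟩ := hx
  obtain ⟨s, hs0, hs1, hs⟩ := hc.exists_index (by linarith [hB.five_le]) 0 i
  rw [zero_add] at hs
  have : k ≤ s := by
    by_contra h
    exact hne s hs0 (by linarith) hs.symm
  obtain ⟨r, hr⟩ := Int.eq_ofNat_of_zero_le (show 0 ≤ s - k by linarith)
  obtain ⟨K', hK', c', hc', hR, h1, h2⟩ := hB.exists_rearranged_index r hK hc k hk (by linarith)
  exact ⟨K', hK', c', hc', hR, by rw [h1, hs]; congr 1; linarith, h2⟩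

/-- Any four vertices of a `g`-cycle can be made consecutive. -/
lemma exists_rearranged_four (hK : K ∈ B) (hc : IsCyc K g c) {x₀ x₁ x₂ x₃ : V}
    (h₀ : x₀ ∈ Set.range c) (h₁ : x₁ ∈ Set.range c) (h₂ : x₂ ∈ Set.range c) (h₃ : x₃ ∈ Set.range c)
    (h01 : x₀ ≠ x₁) (h02 : x₀ ≠ x₂) (h03 : x₀ ≠ x₃) (h12 : x₁ ≠ x₂) (h13 : x₁ ≠ x₃)
    (h23 : x₂ ≠ x₃) : ∃ K' ∈ B, ∃ c', IsCyc K' g c' ∧ Rearranged K c K' c' ∧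
      c' 0 = x₀ ∧ c' 1 = x₁ ∧ c' 2 = x₂ ∧ c' 3 = x₃ := by
  obtain ⟨K₀, hK₀, c₀, hc₀, hR₀, a0, -⟩ := hB.exists_rearranged hK hc le_rfl h₀
    (fun i h h' => by linarith)
  obtain ⟨K₁, hK₁, c₁, hc₁, hR₁, b1, b⟩ := hB.exists_rearranged hK₀ hc₀ (k := 1) (by simp)
    (hR₀.range_eq ▸ h₁) (fun i h h' => by obtain rfl : i = 0 := by omega
                                          rwa [a0])
  have hR₁ := hR₀.trans hR₁
  have b0 := b 0 (by simp) (by simp)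
  rw [a0] at b0
  obtain ⟨K₂, hK₂, c₂, hc₂, hR₂, d2, d⟩ := hB.exists_rearranged hK₁ hc₁ (k := 2) (by simp)
    (hR₁.range_eq ▸ h₂) (fun i h h' => by
      obtain rfl | rfl : i = 0 ∨ i = 1 := by omega
      · rwa [b0]
      · rwa [b1])
  have hR₂ := hR₁.trans hR₂
  have d0 := d 0 (by simp) (by simp)
  have d1 := d 1 (by simp) (by simp)
  rw [b0] at d0
  rw [b1] at d1
  obtain ⟨K₃, hK₃, c₃, hc₃, hR₃, e3, e⟩ := hB.exists_rearranged hK₂ hc₂ (k := 3) (by simp)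
    (hR₂.range_eq ▸ h₃) (fun i h h' => by
      obtain rfl | rfl | rfl : i = 0 ∨ i = 1 ∨ i = 2 := by omega
      · rwa [d0]
      · rwa [d1]
      · rwa [d2])
  exact ⟨K₃, hK₃, c₃, hc₃, hR₂.trans hR₃, (e 0 (by simp) (by simp)).trans d0,
    (e 1 (by simp) (by simp)).trans d1, (e 2 (by simp) (by simp)).trans d2, e3⟩

end SwitchFamily
end

section
variable {V : Type*} {G K K' : SimpleGraph V} {B : Set (SimpleGraph V)} {g m : ℤ} {c c' z : ℤ → V}
  {S : Set V} {x y : V}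

lemma GirthGE.not_triangle (hG : GirthGE K g) (hg : 5 ≤ g) {x y v : V} (h1 : K.Adj x y)
    (h2 : K.Adj y v) (h3 : K.Adj v x) : False := by
  have := hG 3 (fun i => if i = 0 then x else if i = 1 then y else if i = 2 then v else x)
    (by simp) (fun i h h' => ?_) (fun i h h' => ?_) (by simp)
  · linarith
  · obtain rfl | rfl | rfl : i = 0 ∨ i = 1 ∨ i = 2 := by omega
    · simpa using h1
    · simpa using h2
    · simpa using h3
  · obtain rfl | rfl : i = 0 ∨ i = 1 := by omega
    · simpa using h3.ne.symm
    · simpa using h1.ne.symm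

lemma GirthGE.notMem_range (hG : GirthGE K g) (hg : 5 ≤ g) (hc : IsCyc K m c) (hm : m ≤ g + 1)
    (hm0 : 0 < m) {p : ℤ} {a : V} (ha : K.Adj (c p) a) (h1 : a ≠ c (p + 1)) (h2 : a ≠ c (p - 1)) :
    a ∉ Set.range c := by
  rintro ⟨s, rfl⟩
  have := hG.two_mul_le hc hm hm0 (p := p) (j := 1) (f := fun i => if i = 0 then c p else c s)
    (fun i h h' => by obtain rfl : i = 0 := by omega
                      simpa using ha) (fun i h h' => by linarith) le_rfl (by simp)
    (by simpa using h1) (by simpa using h2) (fun i h h' => by linarith) ⟨s, by simp⟩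
  linarith

/-- There is a path of length `g - 1` from `x` to `y` without inner vertices in `S`. -/
def Linked (K : SimpleGraph V) (S : Set V) (g : ℤ) (x y : V) : Prop :=
  ∃ f : ℤ → V, f 0 = x ∧ f (g - 1) = y ∧ (∀ i, 0 ≤ i → i < g - 1 → K.Adj (f i) (f (i + 1))) ∧
    (∀ i, 0 ≤ i → i + 2 ≤ g - 1 → f i ≠ f (i + 2)) ∧ ∀ i, 1 ≤ i → i ≤ g - 2 → f i ∉ S

lemma Linked.symm (h : Linked K S g x y) : Linked K S g y x := by
  obtain ⟨f, h0, h1, h2, h3, h4⟩ := h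
  refine ⟨fun i => f (g - 1 - i), by simpa using h1, by simpa using h0, fun i hi hi' => ?_,
    fun i hi hi' => ?_, fun i hi hi' => h4 _ (by linarith) (by linarith)⟩
  · have := h2 (g - 1 - (i + 1)) (by linarith) (by linarith)
    rw [show g - 1 - (i + 1) + 1 = g - 1 - i by ring] at this
    exact this.symm
  · have := h3 (g - 1 - (i + 2)) (by linarith) (by linarith)
    rw [show g - 1 - (i + 2) + 2 = g - 1 - i by ring] at this
    exact this.symm

/-- A relabelling of the graph outside `S` maps linked pairs to linked pairs. -/
lemma Linked.map (hg : 3 ≤ g) (h : Linked K S g x y) (σ : Equiv.Perm V)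
    (hσ : ∀ v, v ∉ S → σ v ∉ S)
    (hadj : ∀ x y, ¬ (x ∈ S ∧ y ∈ S) → K.Adj x y → K'.Adj (σ x) (σ y)) :
    Linked K' S g (σ x) (σ y) := by
  obtain ⟨f, h0, h1, h2, h3, h4⟩ := h
  refine ⟨fun i => σ (f i), congrArg σ h0, congrArg σ h1, fun i hi hi' => hadj _ _ ?_ (h2 i hi hi'),
    fun i hi hi' h => h3 i hi hi' (σ.injective h), fun i hi hi' => hσ _ (h4 i hi hi')⟩
  rintro ⟨h5, h6⟩
  rcases eq_or_lt_of_le hi with rfl | hi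
  · exact h4 (0 + 1) (by simp) (by linarith) h6
  · exact h4 i (by linarith) (by linarith) h5

lemma Linked.of_adj_iff (hg : 3 ≤ g) (h : Linked K S g x y)
    (hadj : ∀ x y, ¬ (x ∈ S ∧ y ∈ S) → (K'.Adj x y ↔ K.Adj x y)) : Linked K' S g x y :=
  h.map hg 1 (fun _ h => h) (fun x y hxy h => (hadj x y hxy).2 h)

/-- A path of length `g - 1` with adjacent ends closes up to a `g`-cycle. -/
lemma GirthGE.isCyc_of_path (hG : GirthGE K g) (hg : 3 ≤ g) {f : ℤ → V}
    (h2 : ∀ i, 0 ≤ i → i < g - 1 → K.Adj (f i) (f (i + 1)))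
    (h3 : ∀ i, 0 ≤ i → i + 2 ≤ g - 1 → f i ≠ f (i + 2)) (h : K.Adj (f (g - 1)) (f 0)) :
    IsCyc K g (fun i => f (i % g)) := by
  refine isCyc_of_injOn hg (fun i hi hi' => h2 i hi (by linarith)) h (fun i j hi hij hj e => ?_)
  have := hG (j - i) (fun t => f (i + t)) (by linarith)
    (fun t h h' => by simpa only [add_assoc] using h2 (i + t) (by linarith) (by linarith))
    (fun t h h' => by simpa only [add_assoc] using h3 (i + t) (by linarith) (by linarith))
    (by simpa using e)
  linarith

namespace SwitchFamily
variable (hB : SwitchFamily B g)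
include hB

lemma linked_of_isCyc (hK : K ∈ B) (hc : IsCyc K g c) (hz : IsCyc K g z) {p : ℤ} (h0 : z 0 = c p)
    (h1 : z 1 ∉ Set.range c) :
    Linked K (Set.range c) g (c p) (c (p + 1)) ∨ Linked K (Set.range c) g (c p) (c (p - 1)) := by
  have hg := hB.five_le
  obtain ⟨t, ht1, ht2, ht⟩ := hB.exists_third hK (v := c p) (a := c (p - 1)) (b := c (p + 1))
    (hc.adj' (by ring)).symm (hc.adj _) (hc.ne' (by ring))
  have e1 : z 1 = t := by
    have := (ht (z 1)).1 (by rw [← h0]; exact hz.adj' (by ring))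
    have := fun s h => h1 ⟨s, h⟩
    grind
  have key : z (g - 1) = z (-1) := hz.per (by ring)
  have h2 := (ht (z (-1))).1 (by rw [← h0]; exact (hz.adj' (by ring)).symm)
  rcases h2 with h2 | h2 | h2
  · exact absurd (h2.trans e1.symm) (hz.ne' (by ring))
  · right
    refine ⟨z, h0, key.trans h2, fun i _ _ => hz.adj i, fun i _ _ => hz.ne i, ?_⟩
    rintro i hi hi' ⟨s, hs⟩
    exact hB.share_avoids hK (hc.reflect p) hz (s := p - s) (by simpa using h0)
      (fun h => h1 ⟨_, h.symm⟩) h2 hi hi' (by rw [← hs]; congr 1; ring)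
  · left
    refine ⟨z, h0, key.trans h2, fun i _ _ => hz.adj i, fun i _ _ => hz.ne i, ?_⟩
    rintro i hi hi' ⟨s, hs⟩
    exact hB.share_avoids hK (hc.shift p) hz (s := s - p) (by simpa using h0)
      (fun h => h1 ⟨_, h.symm⟩) (by simpa [add_comm] using h2) hi hi'
      (by rw [← hs]; congr 1; ring)

lemma eq_of_linked_of_adj (hK : K ∈ B) {f f' : ℤ → V} {x y y' : V} (hx : f 0 = x) (hx' : f' 0 = x)
    (hy : f (g - 1) = y) (hy' : f' (g - 1) = y')
    (h : ∀ i, 0 ≤ i → i < g - 1 → K.Adj (f i) (f (i + 1)))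
    (hn : ∀ i, 0 ≤ i → i + 2 ≤ g - 1 → f i ≠ f (i + 2))
    (h' : ∀ i, 0 ≤ i → i < g - 1 → K.Adj (f' i) (f' (i + 1)))
    (hn' : ∀ i, 0 ≤ i → i + 2 ≤ g - 1 → f' i ≠ f' (i + 2))
    (h1 : f 1 = f' 1) (h2 : f 2 = f' 2) (hxy : K.Adj x y) (hxy' : K.Adj x y') : y = y' := by
  have hg := hB.five_le
  have hG := hB.girth K hK
  have c1 := hG.isCyc_of_path (by linarith) h hn (by rw [hx, hy]; exact hxy.symm)
  have c2 := hG.isCyc_of_path (by linarith) h' hn' (by rw [hx', hy']; exact hxy'.symm)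
  have m0 : (2 - 0) % g = 2 := Int.emod_eq_of_lt (by simp) (by linarith)
  have m1 : (2 - 1) % g = 1 := Int.emod_eq_of_lt (by simp) (by linarith)
  have m2 : (2 - 2) % g = 0 := Int.emod_eq_of_lt (by simp) (by linarith)
  have m3 : (2 - 3) % g = g - 1 := by
    rw [← Int.add_emod_right, show 2 - 3 + g = g - 1 by ring]
    exact Int.emod_eq_of_lt (by linarith) (by linarith)
  have := hB.cyc_unique hK (c1.reflect 2) (c2.reflect 2)
    (by rw [m0]; exact h2) (by rw [m1]; exact h1) (by rw [m2, hx, hx'])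
  rwa [m3, hy, hy'] at this

variable [DecidableEq V]

lemma not_linked_three (hK : K ∈ B) (hc : IsCyc K g c) {x y₁ y₂ y₃ : V} (hx : x ∈ Set.range c)
    (hy₁ : y₁ ∈ Set.range c) (hy₂ : y₂ ∈ Set.range c) (hy₃ : y₃ ∈ Set.range c)
    (hxy₁ : x ≠ y₁) (hxy₂ : x ≠ y₂) (hxy₃ : x ≠ y₃) (h12 : y₁ ≠ y₂) (h13 : y₁ ≠ y₃) (h23 : y₂ ≠ y₃)
    (h₁ : Linked K (Set.range c) g x y₁) (h₂ : Linked K (Set.range c) g x y₂)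
    (h₃ : Linked K (Set.range c) g x y₃) : False := by
  have hg := hB.five_le
  have key : ∀ {y y' y'' : V} {f f' : ℤ → V}, y ∈ Set.range c → y' ∈ Set.range c →
      y'' ∈ Set.range c → x ≠ y → x ≠ y' → x ≠ y'' → y ≠ y' → y ≠ y'' → y' ≠ y'' →
      f 0 = x → f' 0 = x → f (g - 1) = y → f' (g - 1) = y' →
      (∀ i, 0 ≤ i → i < g - 1 → K.Adj (f i) (f (i + 1))) →
      (∀ i, 0 ≤ i → i + 2 ≤ g - 1 → f i ≠ f (i + 2)) →
      (∀ i, 0 ≤ i → i < g - 1 → K.Adj (f' i) (f' (i + 1))) →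
      (∀ i, 0 ≤ i → i + 2 ≤ g - 1 → f' i ≠ f' (i + 2)) →
      (∀ i, 1 ≤ i → i ≤ g - 2 → f i ∉ Set.range c) →
      (∀ i, 1 ≤ i → i ≤ g - 2 → f' i ∉ Set.range c) → f 1 = f' 1 → f 2 ≠ f' 2 := by
    intro y y' y'' f f' hy hy' hy'' n1 n2 n3 n4 n5 n6 e1 e2 e3 e4 a1 b1 a2 b2 s1 s2 k1 k2
    obtain ⟨K', hK', c', hc', hR, i0, i1, i2, -⟩ := hB.exists_rearranged_four hK hc hy hx hy' hy''
      n1.symm n4 n5 n2 n3 n6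
    have tr : ∀ f : ℤ → V, (∀ i, 0 ≤ i → i < g - 1 → K.Adj (f i) (f (i + 1))) →
        (∀ i, 1 ≤ i → i ≤ g - 2 → f i ∉ Set.range c) →
        ∀ i, 0 ≤ i → i < g - 1 → K'.Adj (f i) (f (i + 1)) := by
      intro f h hf i hi hi'
      refine (hR.adj_iff _ _ fun hh => ?_).2 (h i hi hi')
      rcases eq_or_lt_of_le hi with rfl | hi
      · exact hf (0 + 1) (by simp) (by linarith) hh.2
      · exact hf i (by linarith) (by linarith) hh.1
    exact n4 (hB.eq_of_linked_of_adj hK' e1 e2 e3 e4 (tr f a1 s1) b1 (tr f' a2 s2) b2 k1 k2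
      (by rw [← i0, ← i1]; exact (hc'.adj' (by ring)).symm)
      (by rw [← i1, ← i2]; exact hc'.adj' (by ring)))
  obtain ⟨f₁, a1, b1, d1, n1, s1⟩ := h₁
  obtain ⟨f₂, a2, b2, d2, n2, s2⟩ := h₂
  obtain ⟨f₃, a3, b3, d3, n3, s3⟩ := h₃
  obtain ⟨p, rfl⟩ := hx
  obtain ⟨t, -, -, ht⟩ := hB.exists_third hK (v := c p) (a := c (p - 1)) (b := c (p + 1))
    (hc.adj' (by ring)).symm (hc.adj _) (hc.ne' (by ring))
  have one : ∀ f : ℤ → V, f 0 = c p → (∀ i, 0 ≤ i → i < g - 1 → K.Adj (f i) (f (i + 1))) →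
      (∀ i, 1 ≤ i → i ≤ g - 2 → f i ∉ Set.range c) → f 1 = t := by
    intro f h0 h hf
    have h1 := h 0 le_rfl (by linarith)
    rw [h0, ht] at h1
    have := hf 1 le_rfl (by linarith)
    have : ∀ s, f 1 ≠ c s := fun s hs => this ⟨s, hs.symm⟩
    simp only [zero_add] at h1
    grind
  have o1 := one f₁ a1 d1 s1
  have o2 := one f₂ a2 d2 s2
  have o3 := one f₃ a3 d3 s3
  obtain ⟨q₁, q₂, q₃, -, -, -, hq⟩ := hB.cubic K hK t
  have hq0 := (hq (c p)).1 ((ht t).2 (Or.inl rfl)).symm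
  have two : ∀ f : ℤ → V, f 0 = c p → (∀ i, 0 ≤ i → i < g - 1 → K.Adj (f i) (f (i + 1))) →
      (∀ i, 0 ≤ i → i + 2 ≤ g - 1 → f i ≠ f (i + 2)) → f 1 = t →
      f 2 ≠ c p ∧ (f 2 = q₁ ∨ f 2 = q₂ ∨ f 2 = q₃) := by
    intro f h0 h hn h1
    refine ⟨fun e => hn 0 le_rfl (by linarith) (by rw [h0, zero_add, e]), ?_⟩
    rw [← hq, ← h1]
    exact h 1 (by simp) (by linarith)
  have t1 := two f₁ a1 d1 n1 o1
  have t2 := two f₂ a2 d2 n2 o2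
  have t3 := two f₃ a3 d3 n3 o3
  have k12 := key hy₁ hy₂ hy₃ hxy₁ hxy₂ hxy₃ h12 h13 h23 a1 a2 b1 b2 d1 n1 d2 n2 s1 s2
    (o1.trans o2.symm)
  have k13 := key hy₁ hy₃ hy₂ hxy₁ hxy₃ hxy₂ h13 h12 h23.symm a1 a3 b1 b3 d1 n1 d3 n3 s1 s3
    (o1.trans o3.symm)
  have k23 := key hy₂ hy₃ hy₁ hxy₂ hxy₃ hxy₁ h23 h12.symm h13.symm a2 a3 b2 b3 d2 n2 d3 n3 s2 s3
    (o2.trans o3.symm)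
  grind

end SwitchFamily
end

section
variable {V : Type*} {G K K' : SimpleGraph V} {B : Set (SimpleGraph V)} {g m : ℤ} {c c' z : ℤ → V}
  {S : Set V} {x y : V}

lemma exists_pair_of_unique {P Q : ℤ → Prop}
    (hP : ∀ i j : ℤ, 2 ≤ i → i ≤ 4 → 2 ≤ j → j ≤ 4 → i ≠ j → P i → ¬ P j)
    (hQ : ∀ i j : ℤ, 2 ≤ i → i ≤ 4 → 2 ≤ j → j ≤ 4 → i ≠ j → Q i → ¬ Q j) :
    ∃ i j : ℤ, 2 ≤ i ∧ i ≤ 4 ∧ 2 ≤ j ∧ j ≤ 4 ∧ i ≠ j ∧ ¬ P i ∧ ¬ Q i ∧ ¬ Q j := by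
  obtain ⟨i, hi, hi', hPi, hQi⟩ : ∃ i, 2 ≤ i ∧ i ≤ 4 ∧ ¬ P i ∧ ¬ Q i := by
    by_contra! h
    have h2 := h 2 le_rfl (by simp)
    have h3 := h 3 (by simp) (by simp)
    have h4 := h 4 (by simp) le_rfl
    have P23 := hP 2 3 (by simp) (by simp) (by simp) (by simp) (by simp)
    have P24 := hP 2 4 (by simp) (by simp) (by simp) (by simp) (by simp)
    have P34 := hP 3 4 (by simp) (by simp) (by simp) (by simp) (by simp)
    have Q23 := hQ 2 3 (by simp) (by simp) (by simp) (by simp) (by simp)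
    have Q24 := hQ 2 4 (by simp) (by simp) (by simp) (by simp) (by simp)
    have Q34 := hQ 3 4 (by simp) (by simp) (by simp) (by simp) (by simp)
    tauto
  obtain ⟨j, k, hj, hj', hk, hk', hij, hik, hjk⟩ : ∃ j k : ℤ, 2 ≤ j ∧ j ≤ 4 ∧ 2 ≤ k ∧ k ≤ 4 ∧
      i ≠ j ∧ i ≠ k ∧ j ≠ k := by
    obtain rfl | rfl | rfl : i = 2 ∨ i = 3 ∨ i = 4 := by omega
    · exact ⟨3, 4, by simp⟩
    · exact ⟨2, 4, by simp⟩
    · exact ⟨2, 3, by simp⟩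
  by_cases h : Q j
  · exact ⟨i, k, hi, hi', hk, hk', hik, hPi, hQi, hQ j k hj hj' hk hk' hjk h⟩
  · exact ⟨i, j, hi, hi', hj, hj', hij, hPi, hQi, h⟩

namespace SwitchFamily
variable [DecidableEq V] (hB : SwitchFamily B g)
include hB

/-- Exchanging the ends of the edges leaving a `g`-cycle at two consecutive vertices. -/
lemma exists_pendant_swap (hK : K ∈ B) (hc : IsCyc K g c) : ∃ K' ∈ B,
    (∀ x ∈ Set.range c, ∀ y ∈ Set.range c, K'.Adj x y ↔ K.Adj x y) ∧
    ∀ x y, ¬ (x ∈ Set.range c ∧ y ∈ Set.range c) →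
      (K'.Adj x y ↔ K.Adj (Equiv.swap (c 0) (c 1) x) (Equiv.swap (c 0) (c 1) y)) := by
  have hg := hB.five_le
  have hG := hB.girth K hK
  obtain ⟨a, ha1, ha2, ha⟩ := hB.exists_third hK (v := c 0) (a := c (-1)) (b := c 1)
    (hc.adj' (by ring)).symm (hc.adj' (by ring)) (hc.ne' (by ring))
  obtain ⟨e, he1, he2, he⟩ := hB.exists_third hK (v := c 1) (a := c 0) (b := c 2)
    (hc.adj' (by ring)).symm (hc.adj' (by ring)) (hc.ne' (by ring))
  have haS := hG.notMem_range hg hc (by linarith) (by linarith) (p := 0)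
    ((ha a).2 (Or.inl rfl)) (by simpa using ha2) (by simpa using ha1)
  have heS := hG.notMem_range hg hc (by linarith) (by linarith) (p := 1)
    ((he e).2 (Or.inl rfl)) (by simpa using he2) (by simpa using he1)
  have m : ∀ i, c i ∈ Set.range c := Set.mem_range_self
  have m0 := m 0
  have m1 := m 1
  have m2 := m 2
  have m3 := m (-1)
  have n01 : c 0 ≠ c 1 := (hc.adj' (by ring)).ne
  refine ⟨_, hB.switch_pendant_mem hK hc ((ha a).2 (Or.inl rfl)) ha1 ha2 ((he e).2 (Or.inl rfl))
    he1 he2, fun x hx y hy => ?_, ?_⟩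
  · rw [switchGraph_adj]
    simp only [Ne, Sym2.eq_iff]
    grind
  set K' := switchGraph K (c 0) (c 1) a e with hK'
  have h1 : ∀ y, y ∉ Set.range c → (K'.Adj (c 0) y ↔ K.Adj (c 1) y) := by
    intro y hy
    rw [hK', switchGraph_adj, ha, he]
    simp only [Ne, Sym2.eq_iff]
    grind
  have h2 : ∀ y, y ∉ Set.range c → (K'.Adj (c 1) y ↔ K.Adj (c 0) y) := by
    intro y hy
    rw [hK', switchGraph_adj, ha, he]
    simp only [Ne, Sym2.eq_iff]
    grind
  have h3 : ∀ x y, x ≠ c 0 → x ≠ c 1 → y ≠ c 0 → y ≠ c 1 → (K'.Adj x y ↔ K.Adj x y) := by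
    intro x y _ _ _ _
    rw [hK', switchGraph_adj]
    simp only [Ne, Sym2.eq_iff]
    grind
  have h4 : ∀ x y, y ∉ Set.range c →
      (K'.Adj x y ↔ K.Adj (Equiv.swap (c 0) (c 1) x) (Equiv.swap (c 0) (c 1) y)) := by
    intro x y hy
    have n0 : y ≠ c 0 := fun h => hy (h ▸ m0)
    have n1 : y ≠ c 1 := fun h => hy (h ▸ m1)
    rw [Equiv.swap_apply_of_ne_of_ne n0 n1]
    by_cases e0 : x = c 0
    · rw [e0, Equiv.swap_apply_left, h1 y hy]
    by_cases e1 : x = c 1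
    · rw [e1, Equiv.swap_apply_right, h2 y hy]
    rw [Equiv.swap_apply_of_ne_of_ne e0 e1, h3 x y e0 e1 n0 n1]
  intro x y hxy
  by_cases hy : y ∈ Set.range c
  · rw [SimpleGraph.adj_comm, h4 y x (fun h => hxy ⟨h, hy⟩), SimpleGraph.adj_comm]
  · exact h4 x y hy

/-- Consecutive vertices of a `g`-cycle are not linked, provided there are other vertices which
are not linked to them. -/
lemma not_linked_of_consecutive (hK : K ∈ B) (hc : IsCyc K g c)
    (h : Linked K (Set.range c) g (c 0) (c 1)) (h1 : ¬ Linked K (Set.range c) g (c 0) (c 2))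
    (h2 : ¬ Linked K (Set.range c) g (c 1) (c 2)) (h3 : ¬ Linked K (Set.range c) g (c 1) (c 3)) :
    False := by
  have hg := hB.five_le
  have hG := hB.girth K hK
  have inj : ∀ {i j : ℤ}, i < j → j < i + g → c i ≠ c j := fun h h' =>
    hc.injOn (hB.girth K hK) (by linarith) h h'
  have m : ∀ i, c i ∈ Set.range c := Set.mem_range_self
  have hS : Set.range (fun i => c (i + 1)) = Set.range c :=
    (Equiv.addRight (1 : ℤ)).surjective.range_comp c
  obtain ⟨K', hK', hin, hout⟩ := hB.exists_pendant_swap hK (hc.shift 1)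
  simp only [zero_add, show (1 : ℤ) + 1 = 2 by norm_num, hS] at hin hout
  set σ := Equiv.swap (c 1) (c 2) with hσ
  have hfix : ∀ v, v ≠ c 1 → v ≠ c 2 → σ v = v := fun v => Equiv.swap_apply_of_ne_of_ne
  have hc' : IsCyc K' g c := hc.mono fun i => (hin _ (m i) _ (m (i + 1))).2 (hc.adj i)
  have hσS : ∀ v, v ∉ Set.range c → σ v = v :=
    fun v hv => hfix v (fun h => hv (h ▸ m 1)) (fun h => hv (h ▸ m 2))
  have link : ∀ {x y}, Linked K' (Set.range c) g x y → Linked K (Set.range c) g (σ x) (σ y) :=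
    fun h => h.map (by linarith) σ (fun v hv => by rwa [hσS v hv])
      (fun x y hxy h => (hout x y hxy).1 h)
  have key : ∀ z, IsCyc K' g z → IsCyc K g z := by
    intro z hz
    refine hz.mono fun i => ?_
    by_contra hi
    have lk : ∀ {z : ℤ → V} {p : ℤ}, IsCyc K' g z → z 0 = c p → p = 1 ∨ p = 2 →
        z 1 ∉ Set.range c → False := by
      intro z p hz h0 hp hz1
      rcases hp with rfl | rfl <;> rcases hB.linked_of_isCyc hK' hc' hz h0 hz1 with h | h <;>
        replace h := link h <;> norm_num [hσ, Equiv.swap_apply_right, Equiv.swap_apply_left] at h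
      · exact h2 h.symm
      · rw [hfix _ (inj (by simp) (by linarith)) (inj (by simp) (by linarith))] at h
        exact h1 h.symm
      · rw [hfix _ (inj (by simp) (by linarith)).symm (inj (by simp) (by linarith)).symm] at h
        exact h3 h
      · exact h2 h
    have hadj := hz.adj i
    by_cases hx : z i ∈ Set.range c
    · by_cases hy : z (i + 1) ∈ Set.range c
      · exact hi ((hin _ hx _ hy).1 hadj)
      · by_cases e : z i = c 1 ∨ z i = c 2
        · rcases e with e | e
          · exact lk (hz.shift i) (p := 1) (by simpa using e) (by simp)
              (by simpa [add_comm] using hy)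
          · exact lk (hz.shift i) (p := 2) (by simpa using e) (by simp)
              (by simpa [add_comm] using hy)
        · push Not at e
          rw [hout _ _ (fun h => hy h.2), hσS _ hy, hfix _ e.1 e.2] at hadj
          exact hi hadj
    · by_cases e : z (i + 1) = c 1 ∨ z (i + 1) = c 2
      · rcases e with e | e
        · exact lk (hz.reflect (i + 1)) (p := 1) (by simpa using e) (by simp) (by simpa using hx)
        · exact lk (hz.reflect (i + 1)) (p := 2) (by simpa using e) (by simp) (by simpa using hx)
      · push Not at e
        rw [hout _ _ (fun h => hx h.1), hσS _ hx, hfix _ e.1 e.2] at hadj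
        exact hi hadj
  obtain ⟨f, f0, fg, fa, fn, fS⟩ := h
  have hz := hG.isCyc_of_path (by linarith) fa fn (by rw [f0, fg]; exact (hc.adj' (by ring)).symm)
  have hz' := (hB.exchange K' hK' K hK key _ hz).adj (g - 2)
  have k1 : (g - 2) % g = g - 2 := Int.emod_eq_of_lt (by linarith) (by linarith)
  have k2 : (g - 2 + 1) % g = g - 1 := by
    rw [show g - 2 + 1 = g - 1 by ring]
    exact Int.emod_eq_of_lt (by linarith) (by linarith)
  have hf := fS (g - 2) (by linarith) le_rfl
  have hf' := fa (g - 2) (by linarith) (by linarith)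
  rw [show g - 2 + 1 = g - 1 by ring, fg] at hf'
  rw [k1, k2, fg, hout _ _ (fun h => hf h.1), hσS _ hf, hσ, Equiv.swap_apply_left] at hz'
  exact hG.not_triangle hg hf' (hc.adj' (by ring)) hz'.symm

lemma not_linked_adj (hK : K ∈ B) (hc : IsCyc K g c) :
    ¬ Linked K (Set.range c) g (c 0) (c 1) := by
  intro h
  have hg := hB.five_le
  have inj : ∀ {i j : ℤ}, i < j → j < i + g → c i ≠ c j := fun h h' =>
    hc.injOn (hB.girth K hK) (by linarith) h h'
  have m : ∀ i, c i ∈ Set.range c := Set.mem_range_self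
  have A : ∀ i j : ℤ, 2 ≤ i → i ≤ 4 → 2 ≤ j → j ≤ 4 → i ≠ j →
      Linked K (Set.range c) g (c 0) (c i) → ¬ Linked K (Set.range c) g (c 0) (c j) := by
    intro i j hi hi' hj hj' hij h1 h2
    refine hB.not_linked_three hK hc (m 0) (m 1) (m i) (m j) (inj (by simp) (by linarith))
      (inj (by linarith) (by linarith)) (inj (by linarith) (by linarith))
      (inj (by linarith) (by linarith)) (inj (by linarith) (by linarith)) ?_ h h1 h2
    rcases lt_or_gt_of_ne hij with h | h
    · exact inj h (by linarith)
    · exact (inj h (by linarith)).symm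
  have X : ∀ i j : ℤ, 2 ≤ i → i ≤ 4 → 2 ≤ j → j ≤ 4 → i ≠ j →
      Linked K (Set.range c) g (c 1) (c i) → ¬ Linked K (Set.range c) g (c 1) (c j) := by
    intro i j hi hi' hj hj' hij h1 h2
    refine hB.not_linked_three hK hc (m 1) (m 0) (m i) (m j) (inj (by simp) (by linarith)).symm
      (inj (by linarith) (by linarith)) (inj (by linarith) (by linarith))
      (inj (by linarith) (by linarith)) (inj (by linarith) (by linarith)) ?_ h.symm h1 h2
    rcases lt_or_gt_of_ne hij with h | h
    · exact inj h (by linarith)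
    · exact (inj h (by linarith)).symm
  obtain ⟨i, j, hi, hi', hj, hj', hij, h1, h2, h3⟩ : ∃ i j : ℤ, 2 ≤ i ∧ i ≤ 4 ∧ 2 ≤ j ∧ j ≤ 4 ∧
      i ≠ j ∧ ¬ Linked K (Set.range c) g (c 0) (c i) ∧ ¬ Linked K (Set.range c) g (c 1) (c i) ∧
      ¬ Linked K (Set.range c) g (c 1) (c j) :=
    exists_pair_of_unique A X
  obtain ⟨K', hK', c', hc', hR, i0, i1, i2, i3⟩ := hB.exists_rearranged_four hK hc (m 0) (m 1)
    (m i) (m j) (inj (by simp) (by linarith)) (inj (by linarith) (by linarith))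
    (inj (by linarith) (by linarith)) (inj (by linarith) (by linarith))
    (inj (by linarith) (by linarith)) (by
      rcases lt_or_gt_of_ne hij with h | h
      · exact inj h (by linarith)
      · exact (inj h (by linarith)).symm)
  have tr : ∀ {x y}, Linked K' (Set.range c) g x y → Linked K (Set.range c) g x y :=
    fun h => h.of_adj_iff (by linarith) fun x y hxy => (hR.adj_iff x y hxy).symm
  refine hB.not_linked_of_consecutive hK' hc' ?_ ?_ ?_ ?_ <;> rw [hR.range_eq]
  · rw [i0, i1]
    exact h.of_adj_iff (by linarith) hR.adj_iff
  · rw [i0, i2]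
    exact fun h => h1 (tr h)
  · rw [i1, i2]
    exact fun h => h2 (tr h)
  · rw [i1, i3]
    exact fun h => h3 (tr h)

/-- Two `g`-cycles through a common vertex share the edges at this vertex. -/
lemma mem_range_of_isCyc (hK : K ∈ B) (hc : IsCyc K g c) (hz : IsCyc K g z) {p : ℤ}
    (h0 : z 0 = c p) : z 1 ∈ Set.range c := by
  by_contra h1
  rcases hB.linked_of_isCyc hK hc hz h0 h1 with h | h
  · refine hB.not_linked_adj hK (hc.shift p) ?_
    rw [show Set.range (fun i => c (i + p)) = Set.range c from
      (Equiv.addRight p).surjective.range_comp c]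
    simpa [add_comm] using h
  · refine hB.not_linked_adj hK (hc.reflect p) ?_
    rw [show Set.range (fun i => c (p - i)) = Set.range c from
      (Equiv.subLeft p).surjective.range_comp c]
    simpa using h

end SwitchFamily
end

section
variable {V : Type*} {G K K' : SimpleGraph V} {B : Set (SimpleGraph V)} {g m : ℤ}
  {c d y z : ℤ → V} {S : Set V}

lemma IsCyc.of_adj_iff (hz : IsCyc K m z) (hm : 3 ≤ m)
    (hS : ∀ j, 2 ≤ j → j ≤ m - 1 → z j ∉ S) (h01 : K'.Adj (z 0) (z 1))
    (h : ∀ x y, ¬ (x ∈ S ∧ y ∈ S) → (K'.Adj x y ↔ K.Adj x y)) : IsCyc K' m z := by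
  refine hz.mono fun i => ?_
  obtain ⟨r, hr0, hr1, hr⟩ := hz.exists_shift (by linarith) 0 i
  have e0 := hr 0
  have e1 := hr 1
  simp only [add_zero, zero_add] at e0 e1
  rw [e0, e1]
  rcases eq_or_lt_of_le hr0 with rfl | hr0
  · simpa using h01
  refine (h _ _ fun hh => ?_).2 (hz.adj r)
  rcases eq_or_lt_of_le (show 1 ≤ r by omega) with rfl | h1
  · exact hS (1 + 1) (by simp) (by linarith) hh.2
  · exact hS r (by linarith) (by linarith) hh.1

namespace SwitchFamily
variable [DecidableEq V] (hB : SwitchFamily B g)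
include hB

lemma mem_range_of_isCyc' (hK : K ∈ B) (hc : IsCyc K g c) (hz : IsCyc K g z) {i j p : ℤ}
    (h0 : z i = c p) (hij : j = i + 1 ∨ i = j + 1) : z j ∈ Set.range c := by
  rcases hij with rfl | rfl
  · simpa [add_comm] using hB.mem_range_of_isCyc hK hc (hz.shift i) (p := p) (by simpa using h0)
  · simpa using hB.mem_range_of_isCyc hK hc (hz.reflect (j + 1)) (p := p) (by simpa using h0)

lemma not_shared_path_of_ne (hK : K ∈ B) (hc : IsCyc K g c) (hd : IsCyc K (g + 1) d)
    (h0 : c 0 ≠ d 0) (h1 : c 1 = d 1) (h2 : c 2 = d 2) (h3 : c 3 = d 3) : False := by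
  have hg := hB.five_le
  have hG := hB.girth K hK
  have inj : ∀ {i j : ℤ}, i < j → j < i + (g + 1) → d i ≠ d j := fun h h' =>
    hd.injOn (hB.girth K hK) (by linarith) h h'
  obtain ⟨f, hf1, hf2, hf⟩ := hB.exists_third hK (v := c 2) (a := c 1) (b := c 3)
    (hc.adj' (by ring)).symm (hc.adj' (by ring)) (hc.ne' (by ring))
  have ha : K.Adj (c 1) (d 0) := by rw [h1]; exact (hd.adj' (by ring)).symm
  have ha2 : d 0 ≠ c 2 := by rw [h2]; exact hd.ne' (by ring)
  have haS := hG.notMem_range hg hc (by linarith) (by linarith) ha (by simpa using ha2)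
    (by simpa using h0.symm)
  have hfS := hG.notMem_range hg hc (by linarith) (by linarith) ((hf f).2 (Or.inl rfl))
    (by simpa using hf2) (by simpa using hf1)
  have hK' := hB.switch_pendant_mem hK (hc.shift 1) (a := d 0) (e := f) (by simpa using ha)
    (by simpa using h0.symm) (by simpa using ha2) (by simpa using (hf f).2 (Or.inl rfl))
    (by simpa using hf1) (by simpa using hf2)
  norm_num at hK'
  have hsub : ∀ z, IsCyc K g z → IsCyc (switchGraph K (c 1) (c 2) (d 0) f) g z := by
    intro z hz
    refine hz.mono fun i => ?_
    rw [switchGraph_adj]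
    refine Or.inl ⟨hz.adj i, ?_, ?_⟩
    · rw [Ne, Sym2.eq_iff]
      rintro (⟨e1, e2⟩ | ⟨e1, e2⟩)
      · exact haS (e2 ▸ hB.mem_range_of_isCyc' hK hc hz e1 (Or.inl rfl))
      · exact haS (e1 ▸ hB.mem_range_of_isCyc' hK hc hz e2 (Or.inr rfl))
    · rw [Ne, Sym2.eq_iff]
      rintro (⟨e1, e2⟩ | ⟨e1, e2⟩)
      · exact hfS (e2 ▸ hB.mem_range_of_isCyc' hK hc hz e1 (Or.inl rfl))
      · exact hfS (e1 ▸ hB.mem_range_of_isCyc' hK hc hz e2 (Or.inr rfl))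
  have old : ∀ i, 2 ≤ i → i < g + 1 →
      (switchGraph K (c 1) (c 2) (d 0) f).Adj (d i) (d (i + 1)) := by
    intro i hi hi'
    rw [switchGraph_adj, h1, h2]
    refine Or.inl ⟨hd.adj i, ?_, ?_⟩
    · rw [Ne, Sym2.eq_iff]
      rintro (⟨e1, e2⟩ | ⟨e1, e2⟩)
      · exact inj (by linarith) (by linarith) e1.symm
      · exact inj (by linarith) (by linarith) e2.symm
    · rw [Ne, Sym2.eq_iff]
      rintro (⟨e1, e2⟩ | ⟨e1, e2⟩)
      · rcases eq_or_lt_of_le hi with rfl | hi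
        · exact hf2 (e2.symm.trans h3.symm)
        · exact inj (by linarith) (by linarith) e1.symm
      · exact inj (by linarith) (by linarith) e2.symm
  have he := isCyc_of_injOn (G := switchGraph K (c 1) (c 2) (d 0) f) (m := g)
    (f := fun i => if i = 0 then d 0 else d (i + 1)) (by linarith) (fun i hi hi' => by
      rcases eq_or_lt_of_le hi with rfl | hi
      · simp only [zero_add, if_true, one_ne_zero, if_false]
        norm_num
        rw [switchGraph_adj, ← h2]
        exact Or.inr ⟨ha2, Or.inr Sym2.eq_swap⟩
      · simp only [hi.ne', if_false, show i + 1 ≠ 0 by linarith]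
        exact old (i + 1) (by linarith) (by linarith))
    (by
      have := old g (by linarith) (by linarith)
      rw [hd.per (i := 0) (j := g + 1) (by ring)] at this
      simpa [show g - 1 ≠ 0 by linarith] using this)
    (fun i j hi hij hj => by
      have hj0 : j ≠ 0 := by linarith
      simp only [hj0, if_false]
      split_ifs with hi0
      · exact inj (by linarith) (by linarith)
      · exact inj (by linarith) (by linarith))
  have hadj := (hB.exchange K hK _ hK' hsub _ he).adj 0
  have m1 : (1 : ℤ) % g = 1 := Int.emod_eq_of_lt (by simp) (by linarith)
  norm_num [m1] at hadj
  exact hG.not_triangle hg (hd.adj' (i := 0) (j := 1) (by ring))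
    (hd.adj' (i := 1) (j := 2) (by ring)) hadj.symm

lemma not_shared_path (hK : K ∈ B) (hc : IsCyc K g c) (hd : IsCyc K (g + 1) d)
    (h0 : c 0 = d 0) (h1 : c 1 = d 1) (h2 : c 2 = d 2) : False := by
  have hex : ∃ n : ℕ, c (-n) ≠ d (-n) := by
    by_contra! h
    have := h g.toNat
    rw [Int.toNat_of_nonneg (by linarith [hB.five_le]), ← hc.periodic, ← hd.periodic] at this
    norm_num [h0, ← h1] at this
    exact (hc.adj' (i := 0) (j := 1) (by ring)).ne (h0.trans this)
  classical
  have hs := Nat.find_spec hex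
  have hmin : ∀ k < Nat.find hex, c (-k) = d (-k) := fun k hk => by
    simpa using Nat.find_min hex hk
  obtain ⟨n, hn⟩ : ∃ n, Nat.find hex = n + 1 :=
    Nat.exists_eq_succ_of_ne_zero fun h => by simp [h, h0] at hs
  rw [hn] at hs hmin
  push_cast at hs
  have hle : ∀ k : ℤ, -n ≤ k → k ≤ 2 → c k = d k := by
    intro k hk hk'
    rcases le_or_gt k 0 with h | h
    · obtain ⟨l, hl⟩ := Int.eq_ofNat_of_zero_le (show 0 ≤ -k by linarith)
      rw [show k = -l by linarith]
      exact hmin l (by omega)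
    · obtain rfl | rfl : k = 1 ∨ k = 2 := by omega
      · exact h1
      · exact h2
  exact hB.not_shared_path_of_ne hK (hc.shift (-(n + 1))) (hd.shift (-(n + 1))) (by simpa using hs)
    (hle _ (by linarith) (by linarith)) (hle _ (by linarith) (by linarith))
    (hle _ (by linarith) (by linarith))

/-- A `g`-cycle and a `(g + 1)`-cycle sharing an edge meet only in the ends of that edge. -/
lemma notMem_range (hK : K ∈ B) (hz : IsCyc K g z) (hd : IsCyc K (g + 1) d) {p : ℤ}
    (h0 : z 0 = d p) (h1 : z 1 = d (p + 1)) {j : ℤ} (hj : 2 ≤ j) (hj' : j ≤ g - 1) :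
    z j ∉ Set.range d := by
  rintro ⟨s, hs⟩
  have n1 : z (-1) ≠ d (p - 1) := fun h => hB.not_shared_path hK (hz.shift (-1))
    (hd.shift (p - 1)) (by simpa using h) (by simpa using h0)
    (by norm_num; rw [h1]; congr 1; ring)
  have n2 : z 2 ≠ d (p + 2) := fun h => hB.not_shared_path hK hz
    (hd.shift p) (by simpa using h0) (by simpa [add_comm] using h1) (by simpa [add_comm] using h)
  refine hB.arc_avoids hK (by linarith) le_rfl hd (hz.shift 1) (p := p + 1) (q := p) (j := j - 1)
    (s := s) (by simpa using h1) ?_ ?_ (by simpa using h0) ?_ ?_ (by linarith) (by linarith)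
    (by simpa using hs.symm)
  · rw [add_assoc]
    exact n2
  · rw [add_sub_cancel_right, ← h0]
    exact (hz.ne' (by ring)).symm
  · rw [← h1]
    exact hz.ne' (by ring)
  · exact n1

lemma swap_isCyc_two (hK : K ∈ B) (hd : IsCyc K (g + 1) d) (k : ℤ) :
    switchGraph K (d k) (d (k + 2)) (d (k - 1)) (d (k + 3)) ∈ B ∧
      IsCyc (switchGraph K (d k) (d (k + 2)) (d (k - 1)) (d (k + 3))) (g + 1)
        (fun i => Equiv.swap (d k) (d (k + 2)) (d (i + k))) := by
  have hd' : IsCyc K (g + 2 - 1) (fun i => d (i + k)) := by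
    rw [show g + 2 - 1 = g + 1 by ring]
    exact hd.shift k
  have h1 := hB.switch_mem hK (Or.inr rfl) hd'
  have h2 := hB.swap_isCyc hK (Or.inr rfl) hd'
  rw [show g + 2 - 1 = g + 1 by ring] at h2
  simp only [zero_add, show -1 + k = k - 1 by ring, show 2 + k = k + 2 by ring,
    show 2 + 1 + k = k + 3 by ring] at h1 h2
  exact ⟨h1, h2⟩

lemma not_crossing_right (hK : K ∈ B) (hz : IsCyc K g z) (hd : IsCyc K (g + 1) d)
    (h0 : z 0 = d 2) (h1 : z 1 = d 3) (hzS : ∀ j, 2 ≤ j → j ≤ g - 1 → z j ∉ Set.range d)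
    (hy : IsCyc K' g y) (hyS : ∀ j, 2 ≤ j → j ≤ g - 1 → y j ∉ Set.range d)
    (hout : ∀ x y, ¬ (x ∈ Set.range d ∧ y ∈ Set.range d) → (K'.Adj x y ↔ K.Adj x y))
    (y0 : y 0 = d 0) (y1 : y 1 = d 3) : False := by
  have hg := hB.five_le
  have inj : ∀ {i j : ℤ}, i < j → j < i + (g + 1) → d i ≠ d j := fun h h' =>
    hd.injOn (hB.girth K hK) (by linarith) h h'
  have m : ∀ i, d i ∈ Set.range d := Set.mem_range_self
  obtain ⟨hK₃, -⟩ := hB.swap_isCyc_two hK hd 1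
  norm_num at hK₃
  set K₃ := switchGraph K (d 1) (d 3) (d 0) (d 4) with hK₃'
  have hout₃ : ∀ x y, ¬ (x ∈ Set.range d ∧ y ∈ Set.range d) → (K₃.Adj x y ↔ K.Adj x y) :=
    fun x y => switchGraph_adj_of_not (m 1) (m 3) (m 0) (m 4)
  have hy₃ : IsCyc K₃ g y := hy.of_adj_iff (by linarith) hyS (by
    rw [hK₃', switchGraph_adj, y0, y1]
    exact Or.inr ⟨inj (by simp) (by linarith), Or.inr Sym2.eq_swap⟩)
    (fun x y h => (hout₃ x y h).trans (hout x y h).symm)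
  have hz₃ : IsCyc K₃ g z := hz.of_adj_iff (by linarith) hzS (by
    rw [hK₃', switchGraph_adj, h0, h1]
    simp only [Ne, Sym2.eq_iff]
    have := inj (i := 1) (j := 2) (by simp) (by linarith)
    have := inj (i := 0) (j := 2) (by simp) (by linarith)
    have := inj (i := 2) (j := 3) (by simp) (by linarith)
    have := inj (i := 2) (j := 4) (by simp) (by linarith)
    have := hd.adj' (i := 2) (j := 3) (by ring)
    tauto) hout₃
  obtain ⟨s, hs⟩ := hB.mem_range_of_isCyc' hK₃ hz₃ hy₃ (i := 1) (j := 0) (p := 1)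
    (y1.trans h1.symm) (Or.inr rfl)
  obtain ⟨r, hr0, hr1, hr⟩ := hz.exists_index (by linarith) 0 s
  rw [hs, y0, zero_add] at hr
  rcases le_or_gt 2 r with h | h
  · exact hzS r h (by linarith) ⟨0, hr⟩
  · obtain rfl | rfl : r = 0 ∨ r = 1 := by omega
    · exact inj (by simp) (by linarith) (hr.trans h0)
    · exact inj (by simp) (by linarith) (hr.trans h1)

lemma not_crossing_left (hK : K ∈ B) (hz : IsCyc K g z) (hd : IsCyc K (g + 1) d)
    (h0 : z 0 = d 2) (h1 : z 1 = d 3) (hzS : ∀ j, 2 ≤ j → j ≤ g - 1 → z j ∉ Set.range d)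
    (hy : IsCyc K' g y) (hyS : ∀ j, 2 ≤ j → j ≤ g - 1 → y j ∉ Set.range d)
    (hout : ∀ x y, ¬ (x ∈ Set.range d ∧ y ∈ Set.range d) → (K'.Adj x y ↔ K.Adj x y))
    (y0 : y 0 = d 2) (y1 : y 1 = d (-1)) : False := by
  have hg := hB.five_le
  have inj : ∀ {i j : ℤ}, i < j → j < i + (g + 1) → d i ≠ d j := fun h h' =>
    hd.injOn (hB.girth K hK) (by linarith) h h'
  have m : ∀ i, d i ∈ Set.range d := Set.mem_range_self
  obtain ⟨hK₂, -⟩ := hB.swap_isCyc_two hK hd (-1)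
  norm_num at hK₂
  set K₂ := switchGraph K (d (-1)) (d 1) (d (-2)) (d 2) with hK₂'
  have hout₂ : ∀ x y, ¬ (x ∈ Set.range d ∧ y ∈ Set.range d) → (K₂.Adj x y ↔ K.Adj x y) :=
    fun x y => switchGraph_adj_of_not (m (-1)) (m 1) (m (-2)) (m 2)
  have hy₂ : IsCyc K₂ g y := hy.of_adj_iff (by linarith) hyS (by
    rw [hK₂', switchGraph_adj, y0, y1]
    exact Or.inr ⟨(inj (by simp) (by linarith)).symm, Or.inl Sym2.eq_swap⟩)
    (fun x y h => (hout₂ x y h).trans (hout x y h).symm)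
  have hz₂ : IsCyc K₂ g z := hz.of_adj_iff (by linarith) hzS (by
    rw [hK₂', switchGraph_adj, h0, h1]
    simp only [Ne, Sym2.eq_iff]
    have := inj (i := 1) (j := 2) (by simp) (by linarith)
    have := inj (i := -1) (j := 2) (by simp) (by linarith)
    have := inj (i := -2) (j := 2) (by simp) (by linarith)
    have := inj (i := 1) (j := 3) (by simp) (by linarith)
    have := hd.adj' (i := 2) (j := 3) (by ring)
    tauto) hout₂
  obtain ⟨s, hs⟩ := hB.mem_range_of_isCyc' hK₂ hz₂ hy₂ (i := 0) (j := 1) (p := 0)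
    (y0.trans h0.symm) (Or.inl rfl)
  obtain ⟨r, hr0, hr1, hr⟩ := hz.exists_index (by linarith) 0 s
  rw [hs, y1, zero_add] at hr
  rcases le_or_gt 2 r with h | h
  · exact hzS r h (by linarith) ⟨_, hr⟩
  · obtain rfl | rfl : r = 0 ∨ r = 1 := by omega
    · exact inj (by simp) (by linarith) (hr.trans h0)
    · exact inj (by simp) (by linarith) (hr.trans h1)

/-- In a switch family, no `g`-cycle shares an edge with a `(g + 1)`-cycle. -/
theorem not_shared_edge (hK : K ∈ B) (hz : IsCyc K g z) (hd : IsCyc K (g + 1) d)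
    (h0 : z 0 = d 2) (h1 : z 1 = d 3) : False := by
  have hg := hB.five_le
  have hG := hB.girth K hK
  have inj : ∀ {i j : ℤ}, i < j → j < i + (g + 1) → d i ≠ d j := fun h h' =>
    hd.injOn (hB.girth K hK) (by linarith) h h'
  have m : ∀ i, d i ∈ Set.range d := Set.mem_range_self
  have hzS : ∀ j, 2 ≤ j → j ≤ g - 1 → z j ∉ Set.range d :=
    fun j => hB.notMem_range hK hz hd h0 (by simpa using h1)
  obtain ⟨hK₁, hd₁⟩ := hB.swap_isCyc_two hK hd 0
  simp only [zero_add, zero_sub, add_zero] at hK₁ hd₁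
  set K₁ := switchGraph K (d 0) (d 2) (d (-1)) (d 3) with hK₁'
  have hout : ∀ x y, ¬ (x ∈ Set.range d ∧ y ∈ Set.range d) → (K₁.Adj x y ↔ K.Adj x y) :=
    fun x y => switchGraph_adj_of_not (m 0) (m 2) (m (-1)) (m 3)
  have hz₁ : ¬ IsCyc K₁ g z := by
    intro h
    have := h.adj' (i := 0) (j := 1) (by ring)
    rw [h0, h1, hK₁', switchGraph_adj] at this
    simp only [Ne, Sym2.eq_iff] at this
    have := inj (i := 0) (j := 2) (by simp) (by linarith)
    have := inj (i := 0) (j := 3) (by simp) (by linarith)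
    have := inj (i := -1) (j := 3) (by simp) (by linarith)
    tauto
  obtain ⟨y, hy, hyK⟩ : ∃ y, IsCyc K₁ g y ∧ ¬ IsCyc K g y := by
    by_contra! h
    exact hz₁ (hB.exchange K₁ hK₁ K hK h z hz)
  obtain ⟨i, hi⟩ : ∃ i, ¬ K.Adj (y i) (y (i + 1)) := by
    by_contra! h
    exact hyK (hy.mono h)
  have hyi := hy.adj i
  rw [hK₁', switchGraph_adj] at hyi
  replace hyi := (hyi.resolve_left fun h => hi h.1).2
  rw [Sym2.eq_iff, Sym2.eq_iff] at hyi
  have hr : ∀ j, Equiv.swap (d 0) (d 2) (d j) ∈ Set.range d := by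
    intro j
    rw [Equiv.swap_apply_def]
    split_ifs <;> exact m _
  have hr' : ∀ j, d j ∈ Set.range (fun i => Equiv.swap (d 0) (d 2) (d i)) := by
    intro j
    obtain ⟨l, hl⟩ := hr j
    exact ⟨l, by simp [hl]⟩
  have f3 : Equiv.swap (d 0) (d 2) (d 3) = d 3 := Equiv.swap_apply_of_ne_of_ne
    (inj (by simp) (by linarith)).symm (inj (by simp) (by linarith)).symm
  have f1 : Equiv.swap (d 0) (d 2) (d (-1)) = d (-1) := Equiv.swap_apply_of_ne_of_ne
    (inj (by simp) (by linarith)) (inj (by simp) (by linarith))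
  have two : ∀ y, IsCyc K₁ g y → y 0 = d 0 → y 1 = d 3 → False := by
    intro y hy y0 y1
    have hyS : ∀ j, 2 ≤ j → j ≤ g - 1 → y j ∉ Set.range d := by
      rintro j hj hj' ⟨s, hs⟩
      exact hB.notMem_range hK₁ hy hd₁ (p := 2) (by simp [y0]) (by norm_num; rw [f3, y1]) hj hj'
        (hs ▸ hr' s)
    exact hB.not_crossing_right hK hz hd h0 h1 hzS hy hyS hout y0 y1
  have one : ∀ y, IsCyc K₁ g y → y 0 = d 2 → y 1 = d (-1) → False := by
    intro y hy y0 y1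
    have hyS : ∀ j, 2 ≤ j → j ≤ g - 1 → y j ∉ Set.range d := by
      rintro j hj hj' ⟨s, hs⟩
      refine hB.notMem_range hK₁ hy (hd₁.reflect 0) (p := 0) (by simp [y0])
        (by norm_num; rw [f1, y1]) hj hj' ?_
      obtain ⟨l, hl⟩ := hr' s
      exact ⟨-l, by simpa [← hs] using hl⟩
    exact hB.not_crossing_left hK hz hd h0 h1 hzS hy hyS hout y0 y1
  rcases hyi with (⟨e1, e2⟩ | ⟨e1, e2⟩) | (⟨e1, e2⟩ | ⟨e1, e2⟩)
  · exact two _ (hy.shift i) (by simpa using e1) (by simpa [add_comm] using e2)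
  · exact two _ (hy.reflect (i + 1)) (by simpa using e2) (by simpa using e1)
  · exact one _ (hy.shift i) (by simpa using e1) (by simpa [add_comm] using e2)
  · exact one _ (hy.reflect (i + 1)) (by simpa using e2) (by simpa using e1)

end SwitchFamily
end

section
variable {V : Type*} {G K K' : SimpleGraph V} {B : Set (SimpleGraph V)} {g m : ℤ} {u w : V}

/-- `K` and `K'` coincide after deleting the vertices `u` and `w`. -/
def AgreeOff (K K' : SimpleGraph V) (u w : V) : Prop :=
  ∀ x y, x ≠ u → x ≠ w → y ≠ u → y ≠ w → (K'.Adj x y ↔ K.Adj x y)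

/-- A family of cubic graphs closed under isomorphism in which no graph is determined by what is
left after deleting two of its vertices. -/
structure ReconFamily (B : Set (SimpleGraph V)) : Prop where
  cubic : ∀ K ∈ B, IsCubic K
  iso : ∀ K ∈ B, ∀ K', Nonempty (K' ≃g K) → K' ∈ B
  exists_not_iso : ∀ K ∈ B, ∀ u w, u ≠ w → ∃ K' ∈ B, AgreeOff K K' u w ∧ ¬ Nonempty (K' ≃g K)

open Classical in
/-- The adjacency indicator. -/
noncomputable def adjInd (K : SimpleGraph V) (x y : V) : ℤ := if K.Adj x y then 1 else 0

lemma adjInd_eq_iff {x y x' y' : V} :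
    adjInd K x y = adjInd K' x' y' ↔ (K.Adj x y ↔ K'.Adj x' y') := by
  unfold adjInd; split_ifs <;> simp_all

lemma adjInd_comm (x y : V) : adjInd K x y = adjInd K y x := adjInd_eq_iff.2 (K.adj_comm x y)

lemma adjInd_self (x : V) : adjInd K x x = 0 := by simp [adjInd]

lemma adjInd_add_eq_iff {x y x' y' : V} : adjInd K' x y + adjInd K' x' y' =
    adjInd K x y + adjInd K x' y' ↔ ((K'.Adj x y ∧ K'.Adj x' y' ↔ K.Adj x y ∧ K.Adj x' y') ∧
      (K'.Adj x y ∨ K'.Adj x' y' ↔ K.Adj x y ∨ K.Adj x' y')) := by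
  unfold adjInd; split_ifs <;> simp_all

variable [Fintype V]

lemma IsCubic.sum_adjInd (hK : IsCubic K) (v : V) : ∑ y, adjInd K v y = 3 := by
  classical
  obtain ⟨a, b, c, hab, hac, hbc, h⟩ := hK v
  have : Finset.univ.filter (K.Adj v) = {a, b, c} := by ext x; simp [h]
  simp only [adjInd, Finset.sum_boole, this]
  rw [Finset.card_eq_three.2 ⟨a, b, c, hab, hac, hbc, rfl⟩]; rfl

namespace AgreeOff
variable (h : AgreeOff K K' u w) (huw : u ≠ w) (hK : IsCubic K) (hK' : IsCubic K')
include h huw hK hK'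

lemma add_adjInd {x : V} (hu : x ≠ u) (hw : x ≠ w) :
    adjInd K' u x + adjInd K' w x = adjInd K u x + adjInd K w x := by
  classical
  have h1 : ∑ y, (adjInd K' x y - adjInd K x y) = 0 := by
    rw [Finset.sum_sub_distrib, hK.sum_adjInd, hK'.sum_adjInd, sub_self]
  rw [Finset.sum_eq_add u w huw (fun y _ hy => ?_) (by simp) (by simp)] at h1
  · simp only [adjInd_comm x] at h1; linarith
  · rw [sub_eq_zero, adjInd_eq_iff]; exact h x y hu hw hy.1 hy.2

lemma adj_iff {x : V} (hu : x ≠ u) (hw : x ≠ w) :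
    (K'.Adj u x ∧ K'.Adj w x ↔ K.Adj u x ∧ K.Adj w x) ∧
      (K'.Adj u x ∨ K'.Adj w x ↔ K.Adj u x ∨ K.Adj w x) :=
  adjInd_add_eq_iff.1 (h.add_adjInd huw hK hK' hu hw)

lemma adj_pair : K'.Adj u w ↔ K.Adj u w := by
  classical
  have h1 : ∑ y, ((adjInd K' u y + adjInd K' w y) - (adjInd K u y + adjInd K w y)) = 0 := by
    simp only [Finset.sum_sub_distrib, Finset.sum_add_distrib, hK.sum_adjInd, hK'.sum_adjInd,
      sub_self]
  rw [Finset.sum_eq_add u w huw (fun y _ hy => ?_) (by simp) (by simp)] at h1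
  · simp only [adjInd_self, adjInd_comm w u] at h1
    rw [← adjInd_eq_iff]; linarith
  · rw [sub_eq_zero]; exact h.add_adjInd huw hK hK' hy.1 hy.2

/-- Equal neighbourhoods of `u` force equality. -/
lemma eq_of_adj_iff (hu : ∀ z, K'.Adj u z ↔ K.Adj u z) : K' = K := by
  have hw : ∀ z, K'.Adj w z ↔ K.Adj w z := by
    intro z
    by_cases hzw : z = w
    · simp [hzw]
    by_cases hzu : z = u
    · rw [hzu, K'.adj_comm, K.adj_comm, hu]
    have h1 := h.add_adjInd huw hK hK' hzu hzw
    have h2 := adjInd_eq_iff.2 (hu z)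
    rw [← adjInd_eq_iff]; linarith
  ext x y
  by_cases hxu : x = u
  · rw [hxu, hu]
  by_cases hxw : x = w
  · rw [hxw, hw]
  by_cases hyu : y = u
  · rw [hyu, K'.adj_comm, K.adj_comm, hu]
  by_cases hyw : y = w
  · rw [hyw, K'.adj_comm, K.adj_comm, hw]
  exact h x y hxu hxw hyu hyw

lemma eq_of_adj {a c : V} (hac : ∀ z, z ≠ u → z ≠ w → z ≠ a → z ≠ c → (K.Adj u z ↔ K.Adj w z))
    (ha : K'.Adj u a ↔ K.Adj u a) : K' = K := by
  classical
  have h0 : ∀ z, z ≠ c → (K'.Adj u z ↔ K.Adj u z) := by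
    intro z hzc
    by_cases hzu : z = u
    · simp [hzu]
    by_cases hzw : z = w
    · rw [hzw]; exact h.adj_pair huw hK hK'
    by_cases hza : z = a
    · rw [hza]; exact ha
    have := h.adj_iff huw hK hK' hzu hzw
    have := hac z hzu hzw hza hzc
    tauto
  have h1 : ∑ y, (adjInd K' u y - adjInd K u y) = 0 := by
    rw [Finset.sum_sub_distrib, hK.sum_adjInd, hK'.sum_adjInd, sub_self]
  rw [Finset.sum_eq_single c (fun y _ hy => by rw [sub_eq_zero, adjInd_eq_iff]; exact h0 y hy)
    (by simp), sub_eq_zero, adjInd_eq_iff] at h1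
  refine h.eq_of_adj_iff huw hK hK' fun z => ?_
  by_cases hzc : z = c
  · rw [hzc]; exact h1
  · exact h0 z hzc

lemma eq_switchGraph {a b c d x y : V} (hab : a ≠ b) (hbx : b ≠ x) (hcd : c ≠ d)
    (hdy : d ≠ y) (hud : u ≠ d) (hwb : w ≠ b)
    (hu : ∀ z, K.Adj u z ↔ z = a ∨ z = b ∨ z = x) (hw : ∀ z, K.Adj w z ↔ z = c ∨ z = d ∨ z = y)
    (hbd : b ≠ d) (hda : d ≠ a) (hdx : d ≠ x)
    (hu' : ∀ z, K'.Adj u z ↔ z = d ∨ z = a ∨ z = x) : K' = switchGraph K u w b d := by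
  have hbu : b ≠ u := ((hu b).2 (by simp)).ne'
  have hdw : d ≠ w := ((hw d).2 (by simp)).ne'
  have hw' : ∀ z, K'.Adj w z ↔ z = c ∨ z = b ∨ z = y := by
    intro z
    by_cases hzw : z = w
    · have h1 := hw w
      simp only [hzw, SimpleGraph.irrefl, false_iff] at h1 ⊢
      tauto
    by_cases hzu : z = u
    · have h1 := h.adj_pair huw hK hK'
      have := hw u
      rw [hzu, K'.adj_comm, h1, K.adj_comm, this]; grind
    have := h.adj_iff huw hK hK' hzu hzw
    rw [hu, hw, hu'] at this
    grind
  have hS : ∀ p q, (switchGraph K u w b d).Adj p q ↔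
    (K.Adj p q ∧ ¬ (p = u ∧ q = b ∨ p = b ∧ q = u) ∧ ¬ (p = w ∧ q = d ∨ p = d ∧ q = w)) ∨
      (p ≠ q ∧ ((p = u ∧ q = d ∨ p = d ∧ q = u) ∨ (p = w ∧ q = b ∨ p = b ∧ q = w))) := by
    intro p q
    rw [switchGraph_adj]; simp only [Ne, Sym2.eq_iff]
  have hSu : ∀ q, K'.Adj u q ↔ (switchGraph K u w b d).Adj u q := by
    intro q; rw [hS, hu', hu]; grind
  have hSw : ∀ q, K'.Adj w q ↔ (switchGraph K u w b d).Adj w q := by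
    intro q; rw [hS, hw', hw]; grind
  ext p q
  by_cases hpu : p = u
  · rw [hpu, hSu]
  by_cases hpw : p = w
  · rw [hpw, hSw]
  by_cases hqu : q = u
  · rw [hqu, K'.adj_comm, hSu, adj_comm]
  by_cases hqw : q = w
  · rw [hqw, K'.adj_comm, hSw, adj_comm]
  rw [hS, h p q hpu hpw hqu hqw]; grind

end AgreeOff

namespace ReconFamily
variable (hB : ReconFamily B)
include hB

lemma exists_ne (hK : K ∈ B) (huw : u ≠ w) {a : V} (hau : K.Adj u a) (haw : a ≠ w) :
    ∃ K' ∈ B, AgreeOff K K' u w ∧ K' ≠ K ∧ K'.Adj u a := by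
  classical
  obtain ⟨K', hK', hoff, hne⟩ := hB.exists_not_iso K hK u w huw
  by_cases ha : K'.Adj u a
  · exact ⟨K', hK', hoff, fun e => hne ⟨e ▸ Iso.refl⟩, ha⟩
  let e : K'.comap (Equiv.swap u w) ≃g K' := Iso.comap (Equiv.swap u w) K'
  refine ⟨_, hB.iso _ hK' _ ⟨e⟩, fun x y h1 h2 h3 h4 => ?_, fun h => hne ⟨h ▸ e.symm⟩, ?_⟩
  · rw [comap_adj, Equiv.swap_apply_of_ne_of_ne h1 h2, Equiv.swap_apply_of_ne_of_ne h3 h4]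
    exact hoff x y h1 h2 h3 h4
  · rw [comap_adj, Equiv.swap_apply_left, Equiv.swap_apply_of_ne_of_ne hau.ne' haw]
    have := (hoff.adj_iff huw (hB.cubic K hK) (hB.cubic _ hK') hau.ne' haw).2
    tauto

/-- Two vertices cannot have the same neighbours apart from one neighbour of each: the deck would
then determine the graph. -/
lemma not_similar (hK : K ∈ B) (huw : u ≠ w) {a c : V} (hau : K.Adj u a) (haw : a ≠ w)
    (hac : ∀ z, z ≠ u → z ≠ w → z ≠ a → z ≠ c → (K.Adj u z ↔ K.Adj w z)) : False := by
  obtain ⟨K', hK', hoff, hne, ha⟩ := hB.exists_ne hK huw hau haw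
  exact hne (hoff.eq_of_adj huw (hB.cubic K hK) (hB.cubic _ hK') hac (by simp [ha, hau]))

lemma not_triangle (hK : K ∈ B) {t : V} (huw : K.Adj u w) (hut : K.Adj u t) (hwt : K.Adj w t) :
    False := by
  obtain ⟨a, ha1, ha2, ha⟩ := (hB.cubic K hK).exists_third huw hut hwt.ne
  obtain ⟨c, hc1, hc2, hc⟩ := (hB.cubic K hK).exists_third huw.symm hwt hut.ne
  refine hB.not_similar hK huw.ne ((ha a).2 (by simp)) ha1 (c := c) fun z h1 h2 h3 h4 => ?_
  rw [ha, hc]; tauto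

lemma not_square (hK : K ∈ B) {s t : V} (huw : u ≠ w) (hst : s ≠ t) (hus : K.Adj u s)
    (hws : K.Adj w s) (hut : K.Adj u t) (hwt : K.Adj w t) : False := by
  obtain ⟨a, ha1, ha2, ha⟩ := (hB.cubic K hK).exists_third hus hut hst
  obtain ⟨c, hc1, hc2, hc⟩ := (hB.cubic K hK).exists_third hws hwt hst
  have hau : K.Adj u a := (ha a).2 (by simp)
  refine hB.not_similar hK huw hau ?_ (c := c) fun z h1 h2 h3 h4 => ?_
  · rintro rfl; exact hB.not_triangle hK hau hus hws
  · rw [ha, hc]; tauto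

lemma switch_or (hK : K ∈ B) {a b c d x y : V} (huw : u ≠ w) (hab : a ≠ b) (hax : a ≠ x)
    (hbx : b ≠ x) (hcd : c ≠ d) (hcy : c ≠ y) (hdy : d ≠ y)
    (hu : ∀ z, K.Adj u z ↔ z = a ∨ z = b ∨ z = x) (hw : ∀ z, K.Adj w z ↔ z = c ∨ z = d ∨ z = y)
    (hxy : x = w ∧ y = u ∨ x = y) : switchGraph K u w b d ∈ B ∨ switchGraph K u w b c ∈ B := by
  have hua : K.Adj u a := (hu a).2 (by simp)
  have hub : K.Adj u b := (hu b).2 (by simp)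
  have hux : K.Adj u x := (hu x).2 (by simp)
  have hwc : K.Adj w c := (hw c).2 (by simp)
  have hwd : K.Adj w d := (hw d).2 (by simp)
  have hwy : K.Adj w y := (hw y).2 (by simp)
  have huw' : K.Adj u w → x = w ∧ y = u := fun h => by
    rcases hxy with h' | rfl
    · exact h'
    · exact (hB.not_triangle hK h hux hwy).elim
  have hcom : ∀ s, K.Adj u s → K.Adj w s → s = x ∧ x = y := fun s h1 h2 => by
    rcases hxy with ⟨rfl, rfl⟩ | rfl
    · exact (hB.not_triangle hK hux h1 h2).elim
    · by_contra h5
      exact hB.not_square hK huw (fun h => h5 ⟨h, rfl⟩) h1 h2 hux hwy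
  have haw : a ≠ w := fun h => hax (h.trans (huw' (h ▸ hua)).1.symm)
  have hbw : b ≠ w := fun h => hbx (h.trans (huw' (h ▸ hub)).1.symm)
  have hbc : b ≠ c := fun h => hbx (hcom b hub (h ▸ hwc)).1
  have hbd : b ≠ d := fun h => hbx (hcom b hub (h ▸ hwd)).1
  have hca : c ≠ a := fun h => hax (hcom a hua (h ▸ hwc)).1
  have hda : d ≠ a := fun h => hax (hcom a hua (h ▸ hwd)).1
  have hby : b ≠ y := fun h => hbx (hcom b hub (h ▸ hwy)).1
  have hcx : c ≠ x := fun h => hcy (h.trans (hcom x hux (h ▸ hwc)).2)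
  have hdx : d ≠ x := fun h => hdy (h.trans (hcom x hux (h ▸ hwd)).2)
  obtain ⟨K', hK', hoff, hne, ha'⟩ := hB.exists_ne hK huw hua haw
  have hc := hB.cubic K hK
  have hc' := hB.cubic K' hK'
  have hp := hoff.adj_pair huw hc hc'
  have hx' : K'.Adj u x := by
    rcases hxy with ⟨rfl, rfl⟩ | rfl
    · exact hp.2 hux
    · exact ((hoff.adj_iff huw hc hc' hux.ne' hwy.ne').1.2 ⟨hux, hwy⟩).1
  obtain ⟨s, hsa, hsx, hs⟩ := hc'.exists_third ha' hx' hax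
  have hs' : K'.Adj u s := (hs s).2 (by simp)
  have hsu : s ≠ u := hs'.ne'
  have hsw : s ≠ w := fun h => hsx (h.trans (huw' (hp.1 (h ▸ hs'))).1.symm)
  have h1 := (hoff.adj_iff huw hc hc' hsu hsw).2.1 (Or.inl hs')
  have h2 : s = b ∨ s = d ∨ s = c := by
    rw [hu, hw] at h1
    rcases h1 with (h | h | h) | (h | h | h)
    · exact (hsa h).elim
    · exact Or.inl h
    · exact (hsx h).elim
    · exact Or.inr (Or.inr h)
    · exact Or.inr (Or.inl h)
    · rcases hxy with ⟨-, h'⟩ | h'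
      · exact (hsu (h.trans h')).elim
      · exact (hsx (h.trans h'.symm)).elim
  rcases h2 with rfl | rfl | rfl
  · refine (hne (hoff.eq_of_adj_iff huw hc hc' fun z => ?_)).elim
    rw [hs, hu, or_left_comm]
  · left
    rw [← hoff.eq_switchGraph huw hc hc' hab hbx hcd hdy hsu.symm hbw.symm hu hw hbd
      hda hdx hs]
    exact hK'
  · right
    rw [← hoff.eq_switchGraph huw hc hc' hab hbx hcd.symm hcy hsu.symm hbw.symm hu
      (fun z => (hw z).trans or_left_comm) hbc hca hcx hs]
    exact hK'

end ReconFamily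
end

section
variable {α V W : Type*} {A : SimpleGraph α} {G : SimpleGraph V} {H : SimpleGraph W} {k : ℕ}

instance [Finite α] [Finite V] : Finite (Copy A G) :=
  Finite.of_injective (fun f : Copy A G => (f : α → V)) DFunLike.coe_injective

/-- Copies in an induced subgraph are the copies supported on its vertices. -/
def copyInduceEquiv (A : SimpleGraph α) (G : SimpleGraph V) (s : Set V) :
    Copy A (G.induce s) ≃ {f : Copy A G // ∀ i, f i ∈ s} where
  toFun f := ⟨(Copy.induce G s).comp f, fun i => (f i).2⟩
  invFun f := ⟨⟨fun i => ⟨f.1 i, f.2 i⟩, fun h => f.1.toHom.map_adj h⟩,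
    fun _ _ h => f.1.injective (congrArg Subtype.val h)⟩
  left_inv _ := rfl
  right_inv _ := rfl

/-- An isomorphism carries copies to copies. -/
def SimpleGraph.Iso.copyEquiv (A : SimpleGraph α) (e : G ≃g H) : Copy A G ≃ Copy A H where
  toFun f := e.toCopy.comp f
  invFun f := e.symm.toCopy.comp f
  left_inv f := by ext i; exact e.symm_apply_apply _
  right_inv f := by ext i; exact e.apply_symm_apply _

variable [Fintype α] [Fintype V] [Fintype W] [DecidableEq V] [DecidableEq W]

/-- Double counting of the copies of `A` in the `k`-vertex induced subgraphs of `G`. -/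
lemma sum_card_copy_induce (hα : Fintype.card α ≤ k) :
    ∑ T : {s : Finset V // s.card = k}, Nat.card (Copy A (G.induce (↑T.1 : Set V))) =
      Nat.card (Copy A G) * (Fintype.card V - Fintype.card α).choose (k - Fintype.card α) := by
  classical
  have := Fintype.ofFinite (Copy A G)
  have h1 : ∀ T : {s : Finset V // s.card = k}, Nat.card (Copy A (G.induce (↑T.1 : Set V))) =
      (Finset.univ.filter fun f : Copy A G => ∀ i, f i ∈ T.1).card := by
    intro T
    rw [Nat.card_congr (copyInduceEquiv A G _), Nat.card_eq_fintype_card, Fintype.card_subtype]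
    rfl
  have h2 : ∀ f : Copy A G, (Finset.univ.filter fun T : {s : Finset V // s.card = k} =>
      ∀ i, f i ∈ T.1).card =
        (Fintype.card V - Fintype.card α).choose (k - Fintype.card α) := by
    intro f
    have h3 : (Finset.univ.map f.toEmbedding).card = Fintype.card α := by simp
    rw [← h3, ← Finset.card_univ (α := V),
      ← Finset.card_filter_powersetCard_subset _ _ _ (Finset.subset_univ _) (h3 ▸ hα)]
    refine Finset.card_bij (fun T _ => T.1) (fun T hT => ?_) (fun _ _ _ _ => Subtype.ext)
      (fun T hT => ?_)
    · simp only [Finset.mem_filter, Finset.mem_univ, true_and] at hT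
      simp only [Finset.mem_filter, Finset.mem_powersetCard, Finset.subset_univ, T.2, true_and]
      intro x hx
      obtain ⟨i, -, rfl⟩ := Finset.mem_map.1 hx
      exact hT i
    · simp only [Finset.mem_filter, Finset.mem_powersetCard] at hT
      exact ⟨⟨T, hT.1.2⟩, by
        simp only [Finset.mem_filter, Finset.mem_univ, true_and]
        exact fun i => hT.2 (Finset.mem_map_of_mem f.toEmbedding (Finset.mem_univ i)), rfl⟩
  simp only [h1]
  have h4 := Finset.sum_card_bipartiteAbove_eq_sum_card_bipartiteBelow
    (s := (Finset.univ : Finset {s : Finset V // s.card = k}))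
    (t := (Finset.univ : Finset (Copy A G))) (fun T f => ∀ i, f i ∈ T.1)
  simp only [Finset.bipartiteAbove, Finset.bipartiteBelow, h2] at h4
  rw [h4]; simp

/-- Kelly's lemma: the `k`-deck determines the number of copies of a graph on at most
`k` vertices. -/
lemma SameDeck.card_copy (h : SameDeck G H k) (hVW : Fintype.card V = Fintype.card W)
    (hα : Fintype.card α ≤ k) (hk : k ≤ Fintype.card V) :
    Nat.card (Copy A G) = Nat.card (Copy A H) := by
  obtain ⟨e, he⟩ := h
  have h1 := sum_card_copy_induce (A := A) (G := G) hα
  have h2 := sum_card_copy_induce (A := A) (G := H) hα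
  rw [← hVW] at h2
  have h3 : ∑ T : {s : Finset V // s.card = k}, Nat.card (Copy A (G.induce (↑T.1 : Set V))) =
      ∑ T : {s : Finset W // s.card = k}, Nat.card (Copy A (H.induce (↑T.1 : Set W))) :=
    Fintype.sum_equiv e _ _ fun T => Nat.card_congr ((he T).some.copyEquiv A)
  rw [h1, h2] at h3
  exact Nat.eq_of_mul_eq_mul_right (Nat.choose_pos (by omega)) h3

lemma SameDeck.symm (h : SameDeck G H k) : SameDeck H G k := by
  obtain ⟨e, he⟩ := h
  refine ⟨e.symm, fun s => ?_⟩
  obtain ⟨f⟩ := he (e.symm s)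
  rw [e.apply_symm_apply] at f
  exact ⟨f.symm⟩

/-- Graphs with the same `(n-2)`-deck can be placed on a common vertex set so that they agree
outside two given vertices. -/
lemma SameDeck.exists_equiv (h : SameDeck G H (Fintype.card V - 2))
    (hVW : Fintype.card V = Fintype.card W) {u w : V} (huw : u ≠ w) :
    ∃ φ : V ≃ W, ∀ x y, x ≠ u → x ≠ w → y ≠ u → y ≠ w → (H.Adj (φ x) (φ y) ↔ G.Adj x y) := by
  classical
  obtain ⟨e, he⟩ := h
  have hT : (Finset.univ \ {u, w} : Finset V).card = Fintype.card V - 2 := by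
    rw [Finset.card_sdiff_of_subset (Finset.subset_univ _), Finset.card_pair huw, Finset.card_univ]
  obtain ⟨f⟩ := he ⟨_, hT⟩
  generalize he' : e ⟨_, hT⟩ = T' at f
  dsimp only at f
  have hc : Fintype.card {x // ¬ x ∈ ((Finset.univ \ {u, w} : Finset V) : Set V)} =
      Fintype.card {x // ¬ x ∈ (T'.1 : Set W)} := by
    rw [Fintype.card_subtype_compl, Fintype.card_subtype_compl]
    simp only [Finset.mem_coe, Fintype.card_coe, T'.2, hT]
    omega
  have e2 := Fintype.equivOfCardEq hc
  let φ : V ≃ W := (Equiv.sumCompl _).symm.trans ((Equiv.sumCongr f.toEquiv e2).trans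
    (Equiv.sumCompl _))
  have hφ : ∀ x (hx : x ∈ ((Finset.univ \ {u, w} : Finset V) : Set V)), φ x = f ⟨x, hx⟩ := by
    intro x hx
    simp only [φ, Equiv.trans_apply]
    rw [Equiv.sumCompl_symm_apply_of_pos hx]
    rfl
  refine ⟨φ, fun x y h1 h2 h3 h4 => ?_⟩
  rw [hφ x (by simp [h1, h2]), hφ y (by simp [h3, h4])]
  exact f.map_adj_iff
end

section
variable {V : Type*} {G K K' : SimpleGraph V} {c : ℤ → V}

lemma SimpleGraph.Copy.isCyc {m : ℕ} (hm : 3 ≤ m) (f : Copy (cycleGraph m) K) :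
    IsCyc K m (fun i => f ⟨(i % m).toNat, by
      have := Int.emod_nonneg i (show (m : ℤ) ≠ 0 by omega)
      have := Int.emod_lt_of_pos i (show (0 : ℤ) < m by omega)
      omega⟩) := by
  have hm0 : NeZero m := ⟨by omega⟩
  have h := isCyc_of_injOn (G := K) (m := m) (f := fun i => f (Fin.ofNat m i.toNat)) (by omega)
    (fun i h0 h1 => f.toHom.map_adj (cycleGraph_adj'.2 (Or.inr ?_)))
    (f.toHom.map_adj (cycleGraph_adj'.2 (Or.inr ?_)))
    (fun i j h0 hij hj e => ?_)
  · convert h using 4 with i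
    have := Int.emod_nonneg i (show (m : ℤ) ≠ 0 by omega)
    have := Int.emod_lt_of_pos i (show (0 : ℤ) < m by omega)
    simp only [Fin.val_ofNat]
    rw [Nat.mod_eq_of_lt (by omega)]
  · obtain ⟨i, rfl⟩ := Int.eq_ofNat_of_zero_le h0
    have h1' : i + 1 < m := by omega
    rw [Fin.sub_val_of_le]
    · simp [Nat.mod_eq_of_lt h1', Nat.mod_eq_of_lt (show i < m by omega)]
    · rw [Fin.le_def]; simp [Nat.mod_eq_of_lt h1', Nat.mod_eq_of_lt (show i < m by omega)]
  · have e1 : ((m : ℤ) - 1).toNat = m - 1 := by omega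
    simp only [e1, Fin.sub_def, Fin.val_ofNat]
    simp [Nat.mod_eq_of_lt (show m - 1 < m by omega), show m - (m - 1) = 1 by omega,
      Nat.mod_eq_of_lt (show 1 < m by omega)]
  · have := congrArg Fin.val (f.injective e)
    simp only [Fin.val_ofNat] at this
    rw [Nat.mod_eq_of_lt (by omega), Nat.mod_eq_of_lt (by omega)] at this
    omega

lemma IsCyc.exists_copy {m : ℕ} (hc : IsCyc K m c)
    (hinj : ∀ i j : ℤ, 0 ≤ i → i < j → j < m → c i ≠ c j) :
    ∃ f : Copy (cycleGraph m) K, ∀ i : Fin m, f i = c i := by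
  have key : ∀ u v : Fin m, (u - v).val = 1 → c u = c (v + 1 : ℤ) := by
    intro u v h
    have hu := u.2
    have hv := v.2
    rw [Fin.sub_def] at h
    simp only at h
    rcases le_or_gt v.val u.val with hle | hlt
    · rw [show m - v.val + u.val = (u.val - v.val) + m by omega, Nat.add_mod_right,
        Nat.mod_eq_of_lt (by omega)] at h
      congr 1; omega
    · rw [Nat.mod_eq_of_lt (by omega)] at h
      exact (hc.per (by omega)).symm
  refine ⟨⟨⟨fun i => c i, fun {u v} h => ?_⟩, fun u v h => ?_⟩, fun _ => rfl⟩
  · rcases cycleGraph_adj'.1 h with h | h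
    · rw [key u v h]; exact (hc.adj _).symm
    · rw [key v u h]; exact hc.adj _
  · by_contra hne
    rcases lt_or_gt_of_ne (Fin.val_ne_of_ne hne) with h1 | h1
    · exact hinj u v (by omega) (by omega) (by omega) h
    · exact hinj v u (by omega) (by omega) (by omega) h.symm

/-- A closed walk without interior backtracking contains a cycle. -/
lemma exists_copy_of_closed (n : ℕ) (f : ℤ → V) (hn : 1 ≤ n)
    (hadj : ∀ i : ℤ, 0 ≤ i → i < n → K.Adj (f i) (f (i + 1)))
    (hne : ∀ i : ℤ, 0 ≤ i → i + 2 ≤ n → f i ≠ f (i + 2)) (h0 : f 0 = f n) :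
    ∃ m, 3 ≤ m ∧ m ≤ n ∧ Nonempty (Copy (cycleGraph m) K) := by
  induction n using Nat.strong_induction_on generalizing f with
  | _ n ih =>
  by_cases hinj : ∀ i j : ℤ, 0 ≤ i → i < j → j < n → f i ≠ f j
  · have h3 : 3 ≤ n := by
      by_contra h
      obtain rfl | rfl : n = 1 ∨ n = 2 := by omega
      · exact (hadj 0 le_rfl (by simp)).ne (by simpa using h0)
      · exact hne 0 le_rfl (by simp) (by simpa using h0)
    have hc := isCyc_of_injOn (G := K) (m := n) (f := f) (by omega)
      (fun i h1 h2 => hadj i h1 (by omega))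
      (by have := hadj (n - 1) (by omega) (by omega); rwa [sub_add_cancel, ← h0] at this) hinj
    obtain ⟨φ, -⟩ := hc.exists_copy fun i j h1 h2 h3 => by
      rw [Int.emod_eq_of_lt h1 (by omega), Int.emod_eq_of_lt (by omega) h3]
      exact hinj i j h1 h2 h3
    exact ⟨n, h3, le_rfl, ⟨φ⟩⟩
  · push Not at hinj
    obtain ⟨i, j, h1, h2, h3, h4⟩ := hinj
    obtain ⟨m, hm, hmn, hf⟩ := ih (j - i).toNat (by omega) (fun t => f (i + t)) (by omega)
      (fun t h5 h6 => by rw [← add_assoc]; exact hadj _ (by omega) (by omega))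
      (fun t h5 h6 => by rw [← add_assoc]; exact hne _ (by omega) (by omega))
      (by rw [Int.toNat_of_nonneg (by omega)]; simpa using h4)
    exact ⟨m, hm, by omega, hf⟩

lemma GirthGE.of_isEmpty_copy {g : ℕ}
    (h : ∀ m, 3 ≤ m → m < g → IsEmpty (Copy (cycleGraph m) K)) : GirthGE K g := by
  intro n f hn hadj hne h0
  obtain ⟨n, rfl⟩ := Int.eq_ofNat_of_zero_le (by omega : 0 ≤ n)
  obtain ⟨m, hm, hmn, hf⟩ := exists_copy_of_closed n f (by omega) hadj hne h0
  by_contra hlt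
  exact (h m hm (by omega)).false hf.some

lemma GirthGE.of_egirth {g : ℕ} (h : G.egirth = g) : GirthGE G g := by
  refine GirthGE.of_isEmpty_copy fun m hm hmg => ⟨fun f => ?_⟩
  obtain ⟨v, p, hp, hl⟩ := (cycleGraph_isContained_iff (G := G) hm).1 ⟨f⟩
  have := egirth_le_length hp
  rw [h, hl] at this
  exact absurd (by exact_mod_cast this) (not_le.2 hmg)

lemma SimpleGraph.Walk.IsCycle.exists_isCyc {v x y : V} {C : G.Walk v v} (hC : C.IsCycle)
    (he : s(x, y) ∈ C.edges) : ∃ c, IsCyc G C.length c ∧ c 0 = x ∧ c 1 = y := by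
  have h3 := hC.three_le_length
  have hc := isCyc_of_injOn (G := G) (m := C.length) (f := fun i => C.getVert i.toNat) (by omega)
    (fun i h0 h1 => by
      rw [show (i + 1).toNat = i.toNat + 1 by omega]
      exact C.adj_getVert_succ (by omega))
    (by
      have := C.adj_getVert_succ (i := C.length - 1) (by omega)
      rw [Nat.sub_add_cancel (by omega), C.getVert_length] at this
      simpa [show ((C.length : ℤ) - 1).toNat = C.length - 1 by omega] using this)
    (fun i j h0 hij hj e => by
      have := hC.getVert_injOn' (show i.toNat ∈ {i | i ≤ C.length - 1} by simp; omega)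
        (show j.toNat ∈ {i | i ≤ C.length - 1} by simp; omega) e
      omega)
  obtain ⟨i, hi, e⟩ := (C.mk_mem_edges_iff_exists).1 he
  have e0 : C.getVert ((i : ℤ) % (C.length : ℤ)).toNat = C.getVert i := by
    rw [Int.emod_eq_of_lt (by omega) (by omega)]; simp
  have e1 : C.getVert (((i : ℤ) + 1) % (C.length : ℤ)).toNat = C.getVert (i + 1) := by
    rcases Nat.lt_or_ge (i + 1) C.length with h | h
    · rw [Int.emod_eq_of_lt (by omega) (by omega)]; rfl
    · have : i + 1 = C.length := by omega
      rw [this, show (i : ℤ) + 1 = C.length by omega]; simp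
  rcases Sym2.eq_iff.1 e with ⟨h1, h2⟩ | ⟨h1, h2⟩
  · refine ⟨_, hc.shift i, ?_, ?_⟩
    · simp only [zero_add, e0, h1]
    · simp only [add_comm (1 : ℤ), e1, h2]
  · refine ⟨_, hc.reflect (i + 1), ?_, ?_⟩
    · simp only [sub_zero, e1, h2]
    · simp only [add_sub_cancel_right, e0, h1]

lemma IsCubic.of_iso {W : Type*} {H : SimpleGraph W} (hH : IsCubic H) (e : K ≃g H) :
    IsCubic K := by
  intro v
  obtain ⟨a, b, c, hab, hac, hbc, h⟩ := hH (e v)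
  refine ⟨e.symm a, e.symm b, e.symm c, by simpa, by simpa, by simpa, fun x => ?_⟩
  rw [← e.map_adj_iff, h]
  simp only [RelIso.eq_symm_apply]

lemma SimpleGraph.IsRegularOfDegree.isCubic [Fintype V] [DecidableRel G.Adj]
    (h : G.IsRegularOfDegree 3) : IsCubic G := by
  classical
  intro v
  obtain ⟨a, b, c, hab, hac, hbc, h⟩ := Finset.card_eq_three.1 (h v)
  exact ⟨a, b, c, hab, hac, hbc, fun x => by rw [← mem_neighborFinset, h]; simp⟩

end

section
variable {V W : Type*} {G : SimpleGraph V} {H : SimpleGraph W}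
  {K : SimpleGraph V} {c : ℤ → V} {B : Set (SimpleGraph V)} {g : ℕ}

lemma GirthGE.add_two_le_card [Fintype V] (hG : GirthGE G g) (hg : 5 ≤ g) (hcub : IsCubic G)
    (hc : IsCyc G g c) : g + 2 ≤ Fintype.card V := by
  classical
  have hg' : (5 : ℤ) ≤ g := by omega
  have hpend : ∀ i, ∃ a, G.Adj (c i) a ∧ a ∉ Set.range c := by
    intro i
    obtain ⟨a, h1, h2, h⟩ := hcub.exists_third (hc.adj i)
      (hc.adj' (j := i) (i := i - 1) (by ring)).symm (hc.ne' (by ring)).symm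
    have ha := (h a).2 (by simp)
    exact ⟨a, ha, hG.notMem_range hg' hc (by omega) (by omega) ha h1 h2⟩
  obtain ⟨a, ha, ha'⟩ := hpend 0
  obtain ⟨b, hb, hb'⟩ := hpend 1
  have hab : a ≠ b := by
    rintro rfl
    exact hG.not_triangle hg' (hc.adj' (i := 0) (j := 1) (by simp)) hb ha.symm
  have hf : Function.Injective fun i : Fin g => c i := by
    intro i j e
    by_contra hne
    rcases lt_or_gt_of_ne (Fin.val_ne_of_ne hne) with h1 | h1
    · exact hc.injOn hG (by omega) (by omega) (by omega) e
    · exact hc.injOn hG (by omega) (by omega) (by omega) e.symm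
  have h2 : (insert a (insert b (Finset.univ.image fun i : Fin g => c i))).card = g + 2 := by
    rw [Finset.card_insert_of_notMem, Finset.card_insert_of_notMem,
      Finset.card_image_of_injective _ hf, Finset.card_univ, Fintype.card_fin]
    · intro h
      obtain ⟨i, -, hi⟩ := Finset.mem_image.1 h
      exact hb' ⟨_, hi⟩
    · intro h
      rcases Finset.mem_insert.1 h with h | h
      · exact hab h
      obtain ⟨i, -, hi⟩ := Finset.mem_image.1 h
      exact ha' ⟨_, hi⟩
  rw [← h2]
  exact Finset.card_le_univ _

/-- Members of a family with equally many `g`-cycles cannot have strictly nested sets of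
`g`-cycles. -/
lemma IsCyc.of_forall [Finite V] {K' : SimpleGraph V} (hg : 3 ≤ g) (hK' : GirthGE K' g)
    (hcard : Nat.card (Copy (cycleGraph g) K') ≤ Nat.card (Copy (cycleGraph g) K))
    (h : ∀ c, IsCyc K g c → IsCyc K' g c) (hc : IsCyc K' g c) : IsCyc K g c := by
  have hcopy : ∀ f : Copy (cycleGraph g) K, ∃ f' : Copy (cycleGraph g) K', ∀ i, f' i = f i := by
    intro f
    have h1 := h _ (f.isCyc hg)
    obtain ⟨f', hf'⟩ := h1.exists_copy fun i j _ h2 h3 => h1.injOn hK' (by omega) h2 (by omega)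
    refine ⟨f', fun i => (hf' i).trans (congrArg f (Fin.ext ?_))⟩
    simp only
    rw [Int.emod_eq_of_lt (by omega) (by omega)]; simp
  choose F hF using hcopy
  have hinj : Function.Injective F := fun f₁ f₂ e =>
    DFunLike.ext _ _ fun i => by rw [← hF, ← hF, e]
  obtain ⟨φ, hφ⟩ := hc.exists_copy fun i j _ h2 h3 => hc.injOn hK' (by omega) h2 (by omega)
  obtain ⟨f, rfl⟩ := (hinj.bijective_of_nat_card_le hcard).2 φ
  refine hc.mono fun i => ?_
  have h1 := (f.isCyc hg).adj i
  have h2 : ∀ i : ℤ, ∀ hi, f ⟨(i % g).toNat, hi⟩ = c i := by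
    intro i hi
    rw [← hF, hφ, ← hc.emod i]
    congr 1
    have := Int.emod_nonneg i (show (g : ℤ) ≠ 0 by omega)
    simp only
    omega
  rwa [h2, h2] at h1

namespace ReconFamily
variable [Fintype V] (hB : ReconFamily B)
include hB

lemma five_le (hK : K ∈ B) (hg : 3 ≤ g) (hc : IsCyc K g c)
    (hinj : ∀ i j : ℤ, 0 ≤ i → i < j → j < g → c i ≠ c j) : 5 ≤ g := by
  by_contra hlt
  have h01 : K.Adj (c 0) (c 1) := hc.adj' (by simp)
  have h12 : K.Adj (c 1) (c 2) := hc.adj' (by simp)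
  have h23 : K.Adj (c 2) (c 3) := hc.adj' (by simp)
  obtain rfl | rfl : g = 3 ∨ g = 4 := by omega
  · rw [hc.per (i := 0) (j := 3) (by simp)] at h23
    exact hB.not_triangle hK h01 h23.symm h12
  · have h34 : K.Adj (c 3) (c 0) := by
      have := hc.adj 3
      rwa [hc.per (i := 0) (j := 3 + 1) (by simp)] at this
    exact hB.not_square hK (hinj 0 2 (by simp) (by simp) (by simp))
      (hinj 1 3 (by simp) (by simp) (by simp)) h01 h12.symm h34.symm h23

lemma switchFamily {G : SimpleGraph V} (hG : G ∈ B) (hGg : GirthGE G g) (hg : 3 ≤ g)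
    (hc : IsCyc G g c)
    (hcard : ∀ K ∈ B, ∀ m ≤ Fintype.card V - 2,
      Nat.card (Copy (cycleGraph m) K) = Nat.card (Copy (cycleGraph m) G)) :
    SwitchFamily B g := by
  have h5 := hB.five_le hG hg hc fun i j _ h2 h3 => hc.injOn hGg (by omega) h2 (by omega)
  have hV := hGg.add_two_le_card h5 (hB.cubic G hG) hc
  have hgirth : ∀ K ∈ B, GirthGE K g := fun K hK => by
    refine GirthGE.of_isEmpty_copy fun m h3 hm => ?_
    rw [← not_nonempty_iff, ← Finite.card_pos_iff, hcard K hK m (by omega), Finite.card_pos_iff]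
    rintro ⟨f⟩
    have := hGg m _ (by omega) (fun i _ _ => (f.isCyc h3).adj i) (fun i _ _ => (f.isCyc h3).ne i)
      ((f.isCyc h3).per (by simp)).symm
    omega
  refine ⟨by omega, hB.cubic, hgirth, fun K hK K' hK' h c hc => ?_, ?_⟩
  · exact IsCyc.of_forall hg (hgirth K' hK')
      (by rw [hcard K hK g (by omega), hcard K' hK' g (by omega)]) h hc
  · intro K hK u w a b c d x y huw hab hax hbx hcd hcy hdy hu hw hxy
    exact hB.switch_or hK huw hab hax hbx hcd hcy hdy hu hw hxy

end ReconFamily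

lemma SameDeck.exists_agreeOff {U X Y : Type*} [Fintype X] [Fintype Y] [DecidableEq X]
    [DecidableEq Y] {G : SimpleGraph X} {H : SimpleGraph Y} {K : SimpleGraph U}
    (h : SameDeck G H (Fintype.card X - 2)) (hXY : Fintype.card X = Fintype.card Y) (e : K ≃g G)
    {u w : U} (huw : u ≠ w) : ∃ K', Nonempty (K' ≃g H) ∧ AgreeOff K K' u w := by
  obtain ⟨φ, hφ⟩ := h.exists_equiv hXY (e.injective.ne huw)
  refine ⟨_, ⟨Iso.comap (e.toEquiv.trans φ) H⟩, fun x y h1 h2 h3 h4 => ?_⟩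
  rw [comap_adj, ← e.map_adj_iff]
  exact hφ _ _ (e.injective.ne h1) (e.injective.ne h2) (e.injective.ne h3) (e.injective.ne h4)

/-- The graphs on `V` isomorphic to `G` or to `H`. -/
def isoClasses (G : SimpleGraph V) (H : SimpleGraph W) : Set (SimpleGraph V) :=
  {K | Nonempty (K ≃g G) ∨ Nonempty (K ≃g H)}

lemma SameDeck.reconFamily [Fintype V] [Fintype W] [DecidableEq V] [DecidableEq W]
    (hdeck : SameDeck G H (Fintype.card V - 2)) (hcard : Fintype.card V = Fintype.card W)
    (hG : IsCubic G) (hH : IsCubic H) (hniso : ¬ Nonempty (G ≃g H)) :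
    ReconFamily (isoClasses G H) where
  cubic := by
    rintro K (⟨⟨e⟩⟩ | ⟨⟨e⟩⟩)
    · exact hG.of_iso e
    · exact hH.of_iso e
  iso := by
    rintro K (⟨⟨e⟩⟩ | ⟨⟨e⟩⟩) K' ⟨f⟩
    · exact Or.inl ⟨f.trans e⟩
    · exact Or.inr ⟨f.trans e⟩
  exists_not_iso := by
    rintro K (⟨⟨e⟩⟩ | ⟨⟨e⟩⟩) u w huw
    · obtain ⟨K', ⟨f⟩, h⟩ := hdeck.exists_agreeOff hcard e huw
      exact ⟨K', Or.inr ⟨f⟩, h, fun ⟨i⟩ => hniso ⟨(e.symm.trans i.symm).trans f⟩⟩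
    · have hdeck' : SameDeck H G (Fintype.card W - 2) := hcard ▸ hdeck.symm
      obtain ⟨K', ⟨f⟩, h⟩ := hdeck'.exists_agreeOff hcard.symm e huw
      exact ⟨K', Or.inl ⟨f⟩, h, fun ⟨i⟩ => hniso ⟨(f.symm.trans i).trans e⟩⟩
end

/-- Standing hypotheses: `G` and `H` are 3-regular graphs on the same number `n` of vertices
with the same `(n-2)`-deck, `H` is not isomorphic to `G`, and `g` is the girth of `G`. -/
theorem no_g_cycle_shares_edge_with_g1_cycle
    {V W : Type*} [Fintype V] [Fintype W] [DecidableEq V] [DecidableEq W]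
    (G : SimpleGraph V) (H : SimpleGraph W)
    [DecidableRel G.Adj] [DecidableRel H.Adj]
    (hG : G.IsRegularOfDegree 3) (hH : H.IsRegularOfDegree 3)
    (hcard : Fintype.card V = Fintype.card W)
    (hdeck : SameDeck G H (Fintype.card V - 2))
    (hniso : ¬ Nonempty (G ≃g H))
    (g : ℕ) (hgirth : G.egirth = g)
    :
    ¬ ∃ (v₁ v₂ : V) (C : G.Walk v₁ v₁) (D : G.Walk v₂ v₂) (e : Sym2 V),
      C.IsCycle ∧ C.length = g ∧ D.IsCycle ∧ D.length = g + 1 ∧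
      e ∈ C.edges ∧ e ∈ D.edges := by
  rintro ⟨v₁, v₂, C, D, e, hC, hCl, hD, hDl, heC, heD⟩
  induction e using Sym2.ind with
  | _ x y =>
  obtain ⟨z, hz, hz0, hz1⟩ := hC.exists_isCyc heC
  obtain ⟨d, hd, hd0, hd1⟩ := hD.exists_isCyc heD
  rw [hCl] at hz
  rw [hDl, Nat.cast_succ] at hd
  have hGB : G ∈ isoClasses G H := Or.inl ⟨Iso.refl⟩
  have hB := (hdeck.reconFamily hcard hG.isCubic hH.isCubic hniso).switchFamily hGB
    (GirthGE.of_egirth hgirth) (hCl ▸ hC.three_le_length) hz (by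
      rintro K (⟨⟨e⟩⟩ | ⟨⟨e⟩⟩) m hm
      · exact Nat.card_congr (e.copyEquiv _)
      · rw [Nat.card_congr (e.copyEquiv _)]
        exact (hdeck.card_copy hcard (by simpa using hm) (Nat.sub_le _ _)).symm)
  exact hB.not_shared_edge hGB hz (hd.shift (-2)) (by simp [hz0, hd0])
    (by simp only [Int.reduceAdd, hz1, hd1, Int.reduceNeg])
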